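/- For n ≥ 1 let bₙ be half the number of subsets S of the 4×n board with |S| = 2n such that both S and its complement are connected (i.e., the number of dissections of the 4×n board into two connected polyominoes of area 2n each), and set b₀ = 1. Then the formal power series f(t) = ∑_{n=0}^∞ bₙ tⁿ ∈ ℚ[[t]] is algebraic of degree at most 2 over ℚ(t): there exist polynomials c₂, c₁, c₀ ∈ ℚ[t], not all zero, with c₂ ≠ 0, such that c₂·f² + c₁·f + c₀ = 0 in ℚ[[t]]. -/

import Mathlib

/-- The grid graph on the `m × n` board: two cells are adjacent when they agree
in one coordinate and differ by exactly 1 in the other. -/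
def gridGraph (m n : ℕ) : SimpleGraph (Fin m × Fin n) :=
  SimpleGraph.fromRel (fun a b =>
    (a.1 = b.1 ∧ (a.2 : ℕ) + 1 = (b.2 : ℕ)) ∨ (a.2 = b.2 ∧ (a.1 : ℕ) + 1 = (b.1 : ℕ)))

/-- A subset of cells is connected if the induced subgraph of the grid graph is
connected (in particular nonempty). -/
def ConnectedRegion (m n : ℕ) (S : Finset (Fin m × Fin n)) : Prop :=
  ((gridGraph m n).induce (S : Set (Fin m × Fin n))).Connected

/-! ## Part 1: power series toolkit -/

namespace Gerry

open PowerSeries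

/-- Power series in `t` over `ℚ`. -/
abbrev PS := PowerSeries ℚ

/-- Laurent polynomials in `y` over `ℚ`. -/
abbrev LP := LaurentPolynomial ℚ

/-- Power series in `t` whose coefficients are Laurent polynomials in `y`. -/
abbrev RR := PowerSeries LP

theorem exists_sqrt (d : PS) (hd : constantCoeff d = 1) :
    ∃ s : PS, s ^ 2 = d ∧ constantCoeff s = 1 := by
  have h0 : constantCoeff (d - 1) = 0 := by simp [hd]
  have hs : HasSubst (d - 1 : PS) := HasSubst.of_constantCoeff_zero' h0
  have hB : (PowerSeries.binomialSeries ℚ (1/2 : ℚ)) ^ 2 = (1 + X : PS) := by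
    rw [pow_two, ← binomialSeries_add]
    have := binomialSeries_nat (R := ℚ) (A := ℚ) 1
    norm_num at this ⊢
    exact this
  refine ⟨(PowerSeries.binomialSeries ℚ (1/2 : ℚ)).subst (d - 1), ?_, ?_⟩
  · rw [← subst_pow hs, hB, subst_add hs, subst_X hs]
    have : (1 : PS).subst (d - 1) = (1 : PS) := by
      rw [← coe_substAlgHom hs, map_one]
    rw [this]; ring
  · have h2 : (PowerSeries.binomialSeries ℚ (1/2 : ℚ)).subst (d - 1) = 1 + (d - 1) * ((mk fun n => coeff (n+1) (PowerSeries.binomialSeries ℚ (1/2 : ℚ)) : PS).subst (d - 1)) := by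
      conv_lhs => rw [eq_X_mul_shift_add_const (PowerSeries.binomialSeries ℚ (1/2 : ℚ))]
      rw [← coe_substAlgHom hs]
      simp only [map_add, map_mul, binomialSeries_constantCoeff, map_one]
      rw [coe_substAlgHom hs, subst_X hs]; ring
    rw [h2]; simp [h0]

/-- The set of power series lying in `ℚ(t) + ℚ(t) s`, where `s ^ 2 = d`. -/
def Wset (s : PS) : Set PS :=
  {f | ∃ p u v : Polynomial ℚ, p ≠ 0 ∧ (p : PS) * f = (u : PS) + (v : PS) * s}

/-- `Wset` as a subring. -/
def W (s : PS) (d : Polynomial ℚ) (hs : s ^ 2 = (d : PS)) : Subring PS where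
  carrier := Wset s
  mul_mem' := by
    rintro a b ⟨p, u, v, hp, h⟩ ⟨p', u', v', hp', h'⟩
    refine ⟨p * p', u * u' + v * v' * d, u * v' + v * u', mul_ne_zero hp hp', ?_⟩
    push_cast
    linear_combination (p' : PS) * b * h + (u + v * s : PS) * h' + (v * v' : PS) * hs
  one_mem' := ⟨1, 1, 0, one_ne_zero, by simp⟩
  add_mem' := by
    rintro a b ⟨p, u, v, hp, h⟩ ⟨p', u', v', hp', h'⟩
    refine ⟨p * p', p' * u + p * u', p' * v + p * v', mul_ne_zero hp hp', ?_⟩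
    push_cast
    linear_combination (p' : PS) * h + (p : PS) * h'
  zero_mem' := ⟨1, 0, 0, one_ne_zero, by simp⟩
  neg_mem' := by
    rintro a ⟨p, u, v, hp, h⟩
    refine ⟨p, -u, -v, hp, ?_⟩
    push_cast
    linear_combination - h

section

variable {s : PS} {d : Polynomial ℚ} {hs : s ^ 2 = (d : PS)}

theorem W.poly (p : Polynomial ℚ) : (p : PS) ∈ W s d hs := ⟨1, p, 0, one_ne_zero, by simp⟩

theorem W.root : s ∈ W s d hs := ⟨1, 0, 1, one_ne_zero, by simp⟩

theorem coe_ne {p : Polynomial ℚ} (h : p ≠ 0) : (p : PS) ≠ 0 := by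
  simpa using h

theorem W.div {g f : PS} (hg : g ∈ W s d hs) (hg0 : g ≠ 0) (h : g * f ∈ W s d hs) :
    f ∈ W s d hs := by
  obtain ⟨p, u, v, hp, hg⟩ := hg
  obtain ⟨p', u', v', hp', h'⟩ := h
  by_cases hN : u ^ 2 - v ^ 2 * d = 0
  · have hN' : ((u : PS) - v * s) * (p * g) = 0 := by
      have : ((u ^ 2 - v ^ 2 * d : Polynomial ℚ) : PS) = 0 := by rw [hN]; simp
      push_cast at this
      linear_combination ((u : PS) - v * s) * hg + this - (v : PS) ^ 2 * hs
    have hpg : (p : PS) * g ≠ 0 := mul_ne_zero (coe_ne hp) hg0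
    have h1 : (u : PS) - v * s = 0 := by
      rcases mul_eq_zero.1 hN' with h | h
      · exact h
      · exact absurd h hpg
    have hu : u ≠ 0 := by
      rintro rfl
      apply hpg
      rw [hg]
      linear_combination - h1 + (2 : PS) * (Polynomial.coe_zero (R := ℚ))
    refine ⟨2 * u * p', p * u', p * v', ?_, ?_⟩
    · exact mul_ne_zero (mul_ne_zero two_ne_zero hu) hp'
    · have h2 : ((2 : Polynomial ℚ) : PS) = 2 := by
        have : (2 : Polynomial ℚ) = 1 + 1 := by norm_num
        rw [this]; push_cast; norm_num
      push_cast
      rw [h2]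
      linear_combination (p : PS) * h' - (p' : PS) * f * hg + (p' * f : PS) * h1
  · refine ⟨(u ^ 2 - v ^ 2 * d) * p', p * (u * u' - v * v' * d), p * (u * v' - v * u'), mul_ne_zero hN hp', ?_⟩
    push_cast
    linear_combination (p : PS) * (u - v * s) * h' - (p' : PS) * f * (u - v * s) * hg
      - (p' * f : PS) * v ^ 2 * hs - (p : PS) * (v * v') * hs + (2 * p' * f : PS) * v ^ 2 * hs

/-- Elements of `W` satisfy a quadratic equation. -/
theorem W.quadratic {f : PS} (hf : f ∈ W s d hs) :
    ∃ c₂ c₁ c₀ : Polynomial ℚ, c₂ ≠ 0 ∧ (c₂ : PS) * f ^ 2 + (c₁ : PS) * f + (c₀ : PS) = 0 := by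
  obtain ⟨p, u, v, hp, h⟩ := hf
  refine ⟨p ^ 2, - (p * u) - p * u, u ^ 2 - v ^ 2 * d, pow_ne_zero 2 hp, ?_⟩
  push_cast
  linear_combination ((p : PS) * f - u + v * s) * h + (v : PS) ^ 2 * hs

end

/-- The embedding of `ℚ[[t]]`. -/
noncomputable def rho : PS →+* RR := PowerSeries.map LaurentPolynomial.C

/-- The power `y ^ k`. -/
noncomputable def Y (k : ℤ) : RR := PowerSeries.C (LaurentPolynomial.T k)

/-- Extraction of the coefficient of `y ^ k`. -/
noncomputable def kap (k : ℤ) (F : RR) : PS := PowerSeries.mk fun n => (coeff n F).coeff k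

theorem Y_zero : Y 0 = 1 := by simp [Y]

theorem Y_add (a b : ℤ) : Y (a + b) = Y a * Y b := by
  rw [Y, LaurentPolynomial.T_add, map_mul]; rfl

theorem Y_pow (a : ℤ) (n : ℕ) : Y a ^ n = Y (n * a) := by
  simp only [Y, ← LaurentPolynomial.T_pow, map_pow]

theorem kap_add (k : ℤ) (F G : RR) : kap k (F + G) = kap k F + kap k G := by
  ext n; simp [kap]

theorem kap_neg (k : ℤ) (F : RR) : kap k (-F) = - kap k F := by
  ext n; simp [kap]

theorem kap_zero (k : ℤ) : kap k 0 = 0 := by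
  ext n; simp [kap]

theorem lp_coeff_sum {ι : Type*} (A : Finset ι) (f : ι → LP) (k : ℤ) :
    (∑ i ∈ A, f i).coeff k = ∑ i ∈ A, (f i).coeff k := by
  classical
  induction A using Finset.induction_on with
  | empty => simp
  | insert a A ha ih => simp [Finset.sum_insert ha, ih]

theorem kap_rho (k : ℤ) (a : PS) (F : RR) : kap k (rho a * F) = a * kap k F := by
  ext n
  simp only [kap, coeff_mk, coeff_mul, rho, coeff_map, lp_coeff_sum]
  refine Finset.sum_congr rfl fun x _ => ?_
  rw [← LaurentPolynomial.smul_eq_C_mul]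
  simp

theorem lp_T_mul (a k : ℤ) (f : LP) : (LaurentPolynomial.T a * f).coeff k = f.coeff (k - a) := by
  have := AddMonoidAlgebra.coeff_single_mul_apply f (1 : ℚ) a k
  rw [one_mul, neg_add_eq_sub] at this
  exact this

theorem kap_Y (k a : ℤ) (F : RR) : kap k (Y a * F) = kap (k - a) F := by
  ext n
  simp only [kap, coeff_mk, Y, coeff_C_mul, lp_T_mul]

theorem kap_one (k : ℤ) : kap k 1 = if k = 0 then 1 else 0 := by
  ext n
  simp only [kap, coeff_mk, coeff_one]
  split_ifs <;> simp_all [← LaurentPolynomial.T_zero, coeff_one]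
  all_goals omega

end Gerry

/-! ## Part 2: coefficient extraction for rational functions -/

namespace Gerry

open PowerSeries

section

variable (w : Subring PS)

/-- One-sided series (bounded below in direction `ε`) with coefficients in `w`. -/
def GG (ε : ℤ) : Set RR :=
  {G | (∀ k, kap k G ∈ w) ∧ ∃ N : ℤ, ∀ k < N, kap (ε * k) G = 0}

/-- Basic denominators in the direction `ε`. -/
def Fac (ε : ℤ) : Set RR :=
  {q | ∃ c ∈ w, ∃ α ∈ w, ∃ e : ℕ, 1 ≤ e ∧ constantCoeff c ≠ 0 ∧ X ∣ α ∧
    q = rho c - rho α * Y (ε * e)}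

/-- Laurent polynomials with coefficients in `w`. -/
noncomputable def Lam : Subring RR := Subring.closure (rho '' w ∪ Set.range Y)

variable {w}

theorem Lam.rho {a : PS} (h : a ∈ w) : rho a ∈ Lam w :=
  Subring.subset_closure (Or.inl ⟨a, h, rfl⟩)

theorem Lam.Y (k : ℤ) : Y k ∈ Lam w :=
  Subring.subset_closure (Or.inr ⟨k, rfl⟩)

theorem isUnit_of_cc {c : PS} (h : constantCoeff c ≠ 0) : IsUnit c := by
  rw [isUnit_iff_constantCoeff]
  exact isUnit_iff_ne_zero.2 h

theorem GG.div_fac (hdiv : ∀ g f : PS, g ∈ w → g ≠ 0 → g * f ∈ w → f ∈ w)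
    {ε : ℤ} (hε : ε * ε = 1) {q G : RR} (hq : q ∈ Fac w ε) (h : q * G ∈ GG w ε) : G ∈ GG w ε := by
  obtain ⟨c, hc, α, hα, e, he, hc0, hX, rfl⟩ := hq
  obtain ⟨hw, N, hN⟩ := h
  have key : ∀ k : ℤ, c * kap (ε * k) G
      = kap (ε * k) ((rho c - rho α * Y (ε * e)) * G) + α * kap (ε * (k - e)) G := by
    intro k
    rw [sub_mul, sub_eq_add_neg, kap_add, kap_neg, mul_assoc, kap_rho, kap_rho, kap_Y, mul_sub]
    ring
  have hcu := isUnit_of_cc hc0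
  have hc1 : c ≠ 0 := by rintro rfl; simp at hc0
  have hdvd : ∀ j : ℕ, ∀ k < N, (X : PS) ^ j ∣ kap (ε * k) G := by
    intro j
    induction j with
    | zero => intro k _; simp
    | succ j ih =>
      intro k hk
      have := key k
      rw [hN k hk, zero_add] at this
      rw [← hcu.dvd_mul_left, this, pow_succ']
      exact mul_dvd_mul hX (ih _ (by omega))
  have hzero : ∀ k < N, kap (ε * k) G = 0 := by
    intro k hk
    ext n
    have := X_pow_dvd_iff.1 (hdvd (n + 1) k hk) n (Nat.lt_succ_self n)
    simpa using this
  have hmem : ∀ n : ℕ, ∀ k < N + n, kap (ε * k) G ∈ w := by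
    intro n
    induction n with
    | zero => intro k hk; rw [hzero k (by simpa using hk)]; exact w.zero_mem
    | succ n ih =>
      intro k hk
      refine hdiv c _ hc hc1 ?_
      rw [key]
      refine w.add_mem (hw _) (w.mul_mem hα (ih _ ?_))
      push_cast at hk
      omega
  refine ⟨fun k => ?_, N, hzero⟩
  have : k = ε * (ε * k) := by rw [← mul_assoc, hε, one_mul]
  rw [this]
  refine hmem (ε * k - N + 1).toNat _ ?_
  have := Int.self_le_toNat (ε * k - N + 1)
  omega

theorem GG.div (hdiv : ∀ g f : PS, g ∈ w → g ≠ 0 → g * f ∈ w → f ∈ w)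
    {ε : ℤ} (hε : ε * ε = 1) {q : RR} (hq : q ∈ Submonoid.closure (Fac w ε)) :
    ∀ G : RR, q * G ∈ GG w ε → G ∈ GG w ε := by
  induction hq using Submonoid.closure_induction with
  | mem x hx => intro G; exact GG.div_fac hdiv hε hx
  | one => intro G h; simpa using h
  | mul x y _ _ hx hy => intro G h; rw [mul_assoc] at h; exact hy _ (hx _ h)

theorem GG.stab {ε : ℤ} (hε : ε * ε = 1) {P : RR} (hP : P ∈ Lam w) :
    ∀ G ∈ GG w ε, P * G ∈ GG w ε := by
  induction hP using Subring.closure_induction with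
  | mem x hx =>
    rintro G ⟨h1, N, h2⟩
    rcases hx with ⟨a, ha, rfl⟩ | ⟨a, rfl⟩
    · refine ⟨fun k => ?_, N, fun k hk => ?_⟩
      · rw [kap_rho]; exact w.mul_mem ha (h1 k)
      · rw [kap_rho, h2 k hk, mul_zero]
    · refine ⟨fun k => ?_, N + ε * a, fun k hk => ?_⟩
      · rw [kap_Y]; exact h1 _
      · rw [kap_Y]
        have : ε * k - a = ε * (k - ε * a) := by
          rw [mul_sub, ← mul_assoc, hε, one_mul]
        rw [this]
        exact h2 _ (by omega)
  | zero =>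
    rintro G -
    rw [zero_mul]
    exact ⟨fun k => by rw [kap_zero]; exact w.zero_mem, 0, fun k _ => kap_zero _⟩
  | one => intro G h; simpa using h
  | add x y _ _ hx hy =>
    intro G h
    obtain ⟨h1, N, h2⟩ := hx G h
    obtain ⟨h1', N', h2'⟩ := hy G h
    refine ⟨fun k => ?_, min N N', fun k hk => ?_⟩
    · rw [add_mul, kap_add]; exact w.add_mem (h1 k) (h1' k)
    · rw [add_mul, kap_add, h2 k (lt_of_lt_of_le hk (min_le_left _ _)),
        h2' k (lt_of_lt_of_le hk (min_le_right _ _)), add_zero]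
  | neg x _ hx =>
    intro G h
    obtain ⟨h1, N, h2⟩ := hx G h
    refine ⟨fun k => ?_, N, fun k hk => ?_⟩
    · rw [neg_mul, kap_neg]; exact w.neg_mem (h1 k)
    · rw [neg_mul, kap_neg, h2 k hk, neg_zero]
  | mul x y _ _ hx hy => intro G h; rw [mul_assoc]; exact hx _ (hy _ h)

theorem GG.one {ε : ℤ} (hε : ε * ε = 1) : (1 : RR) ∈ GG w ε := by
  refine ⟨fun k => ?_, 0, fun k hk => ?_⟩
  · rw [kap_one]; split_ifs
    · exact w.one_mem
    · exact w.zero_mem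
  · rw [kap_one, if_neg]
    intro h
    rcases mul_eq_zero.1 h with h | h
    · subst h; simp at hε
    · omega

theorem GG.lam {ε : ℤ} (hε : ε * ε = 1) {P : RR} (hP : P ∈ Lam w) : P ∈ GG w ε := by
  simpa using GG.stab hε hP 1 (GG.one hε)

/-- Coprimality up to a nonzero scalar of `w`. -/
def Cop (w : Subring PS) (p q : RR) : Prop :=
  ∃ r ∈ w, r ≠ 0 ∧ ∃ U ∈ Lam w, ∃ V ∈ Lam w, rho r = U * p + V * q

theorem Cop.symm {p q : RR} (h : Cop w p q) : Cop w q p := by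
  obtain ⟨r, hr, h0, U, hU, V, hV, h⟩ := h
  exact ⟨r, hr, h0, V, hV, U, hU, by rw [h, add_comm]⟩

theorem Cop.one (p : RR) : Cop w p 1 :=
  ⟨1, w.one_mem, one_ne_zero, 0, (Lam w).zero_mem, 1, (Lam w).one_mem, by simp⟩

theorem Cop.mul {p q q' : RR} (hp : p ∈ Lam w) (hq : q ∈ Lam w) (h : Cop w p q) (h' : Cop w p q') :
    Cop w p (q * q') := by
  obtain ⟨r, hr, h0, U, hU, V, hV, h⟩ := h
  obtain ⟨r', hr', h0', U', hU', V', hV', h'⟩ := h'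
  refine ⟨r * r', w.mul_mem hr hr', mul_ne_zero h0 h0', U * rho r' + V * q * U', ?_, V * V',
    mul_mem hV hV', ?_⟩
  · exact add_mem (mul_mem hU (Lam.rho hr')) (mul_mem (mul_mem hV hq) hU')
  · rw [map_mul]
    linear_combination (rho r') * h + (V * q) * h'

theorem Fac.lam {ε : ℤ} {q : RR} (h : q ∈ Fac w ε) : q ∈ Lam w := by
  obtain ⟨c, hc, α, hα, e, he, hc0, hX, rfl⟩ := h
  exact sub_mem (Lam.rho hc) (mul_mem (Lam.rho hα) (Lam.Y _))

theorem lam_of_closure {ε : ℤ} {q : RR} (h : q ∈ Submonoid.closure (Fac w ε)) : q ∈ Lam w := by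
  induction h using Submonoid.closure_induction with
  | mem x hx => exact Fac.lam hx
  | one => exact one_mem _
  | mul x y _ _ hx hy => exact mul_mem hx hy

theorem pow_sub_lam {a b : RR} (ha : a ∈ Lam w) (hb : b ∈ Lam w) (n : ℕ) :
    ∃ U ∈ Lam w, a ^ n - b ^ n = U * (a - b) := by
  induction n with
  | zero => exact ⟨0, zero_mem _, by simp⟩
  | succ n ih =>
    obtain ⟨U, hU, h⟩ := ih
    refine ⟨a ^ n + U * b, add_mem (pow_mem ha n) (mul_mem hU hb), ?_⟩
    linear_combination b * h

theorem Cop.fac {p q : RR} (hp : p ∈ Fac w 1) (hq : q ∈ Fac w (-1)) : Cop w p q := by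
  obtain ⟨c, hc, α, hα, e, he, hc0, hX, rfl⟩ := hp
  obtain ⟨c', hc', α', hα', e', he', hc0', hX', rfl⟩ := hq
  obtain ⟨U, hU, h⟩ := pow_sub_lam (Lam.rho hc) (mul_mem (Lam.rho hα) (Lam.Y (1 * e))) e'
  obtain ⟨V, hV, h'⟩ := pow_sub_lam (Lam.rho hc') (mul_mem (Lam.rho hα') (Lam.Y (-1 * e'))) e
  refine ⟨c ^ e' * c' ^ e - α ^ e' * α' ^ e, ?_, ?_, U * rho (c' ^ e), ?_,
    (rho α * Y (1 * e)) ^ e' * V, ?_, ?_⟩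
  · exact sub_mem (mul_mem (pow_mem hc _) (pow_mem hc' _)) (mul_mem (pow_mem hα _) (pow_mem hα' _))
  · intro h0
    have := congrArg constantCoeff h0
    have hα0 : constantCoeff α = 0 := X_dvd_iff.1 hX
    have he0 : e' ≠ 0 := by omega
    rw [map_sub, map_mul, map_mul, map_pow, map_pow, map_pow, map_pow, hα0, zero_pow he0] at this
    simp only [zero_mul, sub_zero, map_zero] at this
    exact mul_ne_zero (pow_ne_zero _ hc0) (pow_ne_zero _ hc0') this
  · exact mul_mem hU (Lam.rho (pow_mem hc' _))
  · exact mul_mem (pow_mem (mul_mem (Lam.rho hα) (Lam.Y _)) _) hV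
  · have hY : Y (1 * e) ^ e' * Y (-1 * e') ^ e = 1 := by
      rw [Y_pow, Y_pow, ← Y_add, ← Y_zero]
      congr 1; ring
    simp only [map_sub, map_mul, map_pow]
    linear_combination (rho c' ^ e) * h + (rho α * Y (1 * e)) ^ e' * h'
      + (rho α ^ e' * rho α' ^ e) * hY

theorem Cop.closure {p q : RR} (hp : p ∈ Submonoid.closure (Fac w 1))
    (hq : q ∈ Submonoid.closure (Fac w (-1))) : Cop w p q := by
  have h1 : ∀ x ∈ Fac w 1, Cop w x q := by
    intro x hx
    induction hq using Submonoid.closure_induction with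
    | mem y hy => exact Cop.fac hx hy
    | one => exact Cop.one x
    | mul y z hy _ ihy ihz => exact Cop.mul (Fac.lam hx) (lam_of_closure hy) ihy ihz
  induction hp using Submonoid.closure_induction with
  | mem y hy => exact h1 y hy
  | one => exact (Cop.one q).symm
  | mul y z hy _ ihy ihz =>
    exact (Cop.mul (lam_of_closure hq) (lam_of_closure hy) ihy.symm ihz.symm).symm

theorem kap_mem (hdiv : ∀ g f : PS, g ∈ w → g ≠ 0 → g * f ∈ w → f ∈ w)
    {a : PS} (ha : a ∈ w) (ha0 : a ≠ 0) {p q H : RR} (hp : p ∈ Submonoid.closure (Fac w 1))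
    (hq : q ∈ Submonoid.closure (Fac w (-1))) (h : rho a * p * q * H ∈ Lam w) (k : ℤ) :
    kap k H ∈ w := by
  obtain ⟨r, hr, h0, U, hU, V, hV, hUV⟩ := Cop.closure hp hq
  have h1 : rho a * q * H ∈ GG w 1 := by
    refine GG.div hdiv (by norm_num) hp _ (GG.lam (by norm_num) ?_)
    convert h using 1; ring
  have h2 : rho a * p * H ∈ GG w (-1) := by
    refine GG.div hdiv (by norm_num) hq _ (GG.lam (by norm_num) ?_)
    convert h using 1; ring
  have h3 := (GG.stab (by norm_num) hV _ h1).1 k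
  have h4 := (GG.stab (by norm_num) hU _ h2).1 k
  have h5 := w.add_mem h3 h4
  rw [← kap_add] at h5
  have h6 : V * (rho a * q * H) + U * (rho a * p * H) = rho (a * r) * H := by
    rw [map_mul, hUV]; ring
  rw [h6, kap_rho] at h5
  exact hdiv _ _ (w.mul_mem ha hr) (mul_ne_zero ha0 h0) h5

/-- Admissible denominators. -/
noncomputable def Den (w : Subring PS) : Submonoid RR where
  carrier := {x | ∃ a ∈ w, a ≠ 0 ∧ ∃ p ∈ Submonoid.closure (Fac w 1),
    ∃ q ∈ Submonoid.closure (Fac w (-1)), x = rho a * p * q}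
  one_mem' := ⟨1, w.one_mem, one_ne_zero, 1, one_mem _, 1, one_mem _, by simp⟩
  mul_mem' := by
    rintro x y ⟨a, ha, ha0, p, hp, q, hq, rfl⟩ ⟨a', ha', ha0', p', hp', q', hq', rfl⟩
    refine ⟨a * a', w.mul_mem ha ha', mul_ne_zero ha0 ha0', p * p', mul_mem hp hp', q * q',
      mul_mem hq hq', ?_⟩
    rw [map_mul]; ring

theorem Den.lam {x : RR} (h : x ∈ Den w) : x ∈ Lam w := by
  obtain ⟨a, ha, ha0, p, hp, q, hq, rfl⟩ := h
  exact mul_mem (mul_mem (Lam.rho ha) (lam_of_closure hp)) (lam_of_closure hq)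

theorem Den.scalar {a : PS} (ha : a ∈ w) (h0 : a ≠ 0) : rho a ∈ Den w :=
  ⟨a, ha, h0, 1, one_mem _, 1, one_mem _, by simp⟩

theorem Den.plus {p : RR} (h : p ∈ Fac w 1) : p ∈ Den w :=
  ⟨1, w.one_mem, one_ne_zero, p, Submonoid.subset_closure h, 1, one_mem _, by simp⟩

theorem Den.minus {p : RR} (h : p ∈ Fac w (-1)) : p ∈ Den w :=
  ⟨1, w.one_mem, one_ne_zero, 1, one_mem _, p, Submonoid.subset_closure h, by simp⟩

/-- Rational functions with admissible denominators. -/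
noncomputable def CC (w : Subring PS) : Subring RR where
  carrier := {F | ∃ q ∈ Den w, q * F ∈ Lam w}
  mul_mem' := by
    rintro x y ⟨q, hq, h⟩ ⟨q', hq', h'⟩
    refine ⟨q * q', mul_mem hq hq', ?_⟩
    have := mul_mem h h'
    convert this using 1; ring
  one_mem' := ⟨1, one_mem _, by simp⟩
  add_mem' := by
    rintro x y ⟨q, hq, h⟩ ⟨q', hq', h'⟩
    refine ⟨q * q', mul_mem hq hq', ?_⟩
    have := add_mem (mul_mem (Den.lam hq') h) (mul_mem (Den.lam hq) h')
    convert this using 1; ring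
  zero_mem' := ⟨1, one_mem _, by simp⟩
  neg_mem' := by
    rintro x ⟨q, hq, h⟩
    refine ⟨q, hq, ?_⟩
    have := neg_mem h
    convert this using 1; ring

theorem CC.lam {x : RR} (h : x ∈ Lam w) : x ∈ CC w := ⟨1, one_mem _, by simpa using h⟩

theorem CC.div {q x : RR} (hq : q ∈ Den w) (h : q * x ∈ CC w) : x ∈ CC w := by
  obtain ⟨q', hq', h⟩ := h
  exact ⟨q' * q, mul_mem hq' hq, by rwa [mul_assoc]⟩

theorem CC.kap (hdiv : ∀ g f : PS, g ∈ w → g ≠ 0 → g * f ∈ w → f ∈ w) {F : RR} (h : F ∈ CC w)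
    (k : ℤ) : kap k F ∈ w := by
  obtain ⟨_, ⟨a, ha, ha0, p, hp, q, hq, rfl⟩, h⟩ := h
  exact kap_mem hdiv ha ha0 hp hq h k

end

end Gerry

/-! ## Part 3: solving the linear system -/

namespace Gerry

/-- Ring-theoretic data used to solve the transfer equations: `C` is a ring closed under division
by certain elements. -/
structure Sys {R : Type*} [CommRing R] (C : Subring R) (t y y' : R) : Prop where
  ht : t ∈ C
  hy : y ∈ C
  hy' : y' ∈ C
  inv : y * y' = 1
  d0 : ∀ x, (1 - t) * x ∈ C → x ∈ C
  d1 : ∀ x, (1 - t * y) * x ∈ C → x ∈ C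
  d1' : ∀ x, (1 - t * y') * x ∈ C → x ∈ C
  d2 : ∀ x, (1 - t * y ^ 2) * x ∈ C → x ∈ C
  d2' : ∀ x, (1 - t * y' ^ 2) * x ∈ C → x ∈ C
  d3 : ∀ x, (1 - t - t * (1 + t) * y) * x ∈ C → x ∈ C
  d3' : ∀ x, (1 - t - t * (1 + t) * y') * x ∈ C → x ∈ C
  d4 : ∀ x, ((1 - t) ^ 2 - t ^ 4) * x ∈ C → x ∈ C
  d5 : ∀ x, ((1 - 2 * t + t ^ 2 - 2 * t ^ 3 - t ^ 4) - t * (1 - t) * (y + y')) * x ∈ C → x ∈ C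

theorem Sys.symm {K : Type*} [CommRing K] {C : Subring K} {t y y' : K} (S : Sys C t y y') : Sys C t y' y where
  ht := S.ht
  hy := S.hy'
  hy' := S.hy
  inv := by rw [mul_comm]; exact S.inv
  d0 := S.d0
  d1 := S.d1'
  d1' := S.d1
  d2 := S.d2'
  d2' := S.d2
  d3 := S.d3'
  d3' := S.d3
  d4 := S.d4
  d5 := by intro x hx; apply S.d5; rwa [add_comm y y']

theorem Sys.trio {K : Type*} [CommRing K] {C : Subring K} {t y y' : K} (S : Sys C t y y') {P Q R p q r : K}
    (hp : p ∈ C) (hq : q ∈ C) (hr : r ∈ C)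
    (h1 : P = t * (P + y * Q + y * R) + p) (h2 : Q = t * (P + y * Q) + q)
    (h3 : R = t * (P + y * R) + r) : P ∈ C ∧ Q ∈ C ∧ R ∈ C := by
  have ht := S.ht
  have hy := S.hy
  have hP : P ∈ C := by
    apply S.d3
    have : (1 - t - t * (1 + t) * y) * P = t * y * q + t * y * r + (1 - t * y) * p := by
      linear_combination (1 - t * y) * h1 + t * y * h2 + t * y * h3
    rw [this]
    repeat' (first | with_reducible assumption | exact one_mem _ | exact zero_mem _ | with_reducible apply add_mem | with_reducible apply sub_mem | with_reducible apply mul_mem | with_reducible apply pow_mem)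
  have hQ : Q ∈ C := by
    apply S.d1
    have : (1 - t * y) * Q = t * P + q := by linear_combination h2
    rw [this]
    repeat' (first | with_reducible assumption | exact one_mem _ | exact zero_mem _ | with_reducible apply add_mem | with_reducible apply sub_mem | with_reducible apply mul_mem | with_reducible apply pow_mem)
  have hR : R ∈ C := by
    apply S.d1
    have : (1 - t * y) * R = t * P + r := by linear_combination h3
    rw [this]
    repeat' (first | with_reducible assumption | exact one_mem _ | exact zero_mem _ | with_reducible apply add_mem | with_reducible apply sub_mem | with_reducible apply mul_mem | with_reducible apply pow_mem)
  exact ⟨hP, hQ, hR⟩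

theorem Sys.five {K : Type*} [CommRing K] {C : Subring K} {t y y' : K} (S : Sys C t y y') {A B D G H a b d g h : K}
    (ha : a ∈ C) (hb : b ∈ C) (hd : d ∈ C) (hg : g ∈ C) (hh : h ∈ C)
    (h1 : A = t * (y' * A + B + y * D + H) + a) (h2 : B = t * (y' * A + B + y * D) + b)
    (h3 : D = t * (y' * A + B + y * D + G) + d)
    (h4 : G = t * (G + y' * A) + g) (h5 : H = t * (H + y * D) + h) :
    A ∈ C ∧ B ∈ C ∧ D ∈ C ∧ G ∈ C ∧ H ∈ C := by
  have ht := S.ht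
  have hy := S.hy
  have hy' := S.hy'
  have hi := S.inv
  obtain ⟨Z, hZ⟩ : ∃ Z, Z = y' * A + B + y * D := ⟨_, rfl⟩
  have k1 : (1 - t) * A = t ^ 2 * y * D + t * (1 - t) * Z + (t * h + (1 - t) * a) := by
    rw [hZ]
    linear_combination (1 - t) * h1 + t * h5
  have k3 : (1 - t) * D = t ^ 2 * y' * A + t * (1 - t) * Z + (t * g + (1 - t) * d) := by
    rw [hZ]
    linear_combination (1 - t) * h3 + t * h4
  obtain ⟨a', ha'⟩ : ∃ a', a' = t * h + (1 - t) * a := ⟨_, rfl⟩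
  obtain ⟨d', hd'⟩ : ∃ d', d' = t * g + (1 - t) * d := ⟨_, rfl⟩
  have ma : a' ∈ C := by
    rw [ha']
    repeat' (first | with_reducible assumption | exact one_mem _ | exact zero_mem _ | with_reducible apply add_mem | with_reducible apply sub_mem | with_reducible apply mul_mem | with_reducible apply pow_mem)
  have md : d' ∈ C := by
    rw [hd']
    repeat' (first | with_reducible assumption | exact one_mem _ | exact zero_mem _ | with_reducible apply add_mem | with_reducible apply sub_mem | with_reducible apply mul_mem | with_reducible apply pow_mem)
  rw [← ha'] at k1
  rw [← hd'] at k3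
  have e1 : ((1 - t) ^ 2 - t ^ 4) * A
      = t * (1 - t) * (1 - t + t ^ 2 * y) * Z + (t ^ 2 * y * d' + (1 - t) * a') := by
    linear_combination (1 - t) * k1 + t ^ 2 * y * k3 + t ^ 4 * A * hi
  have e3 : ((1 - t) ^ 2 - t ^ 4) * D
      = t * (1 - t) * (1 - t + t ^ 2 * y') * Z + (t ^ 2 * y' * a' + (1 - t) * d') := by
    linear_combination (1 - t) * k3 + t ^ 2 * y' * k1 + t ^ 4 * D * hi
  have mZ : Z ∈ C := by
    apply S.d5
    apply S.d0
    have : (1 - t) * (((1 - 2 * t + t ^ 2 - 2 * t ^ 3 - t ^ 4) - t * (1 - t) * (y + y')) * Z)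
        = y' * (t ^ 2 * y * d' + (1 - t) * a') + y * (t ^ 2 * y' * a' + (1 - t) * d')
          + ((1 - t) ^ 2 - t ^ 4) * b := by
      linear_combination ((1 - t) ^ 2 - t ^ 4) * hZ + y' * e1 + y * e3 + ((1 - t) ^ 2 - t ^ 4) * h2
        - ((1 - t) ^ 2 - t ^ 4) * t * hZ + 2 * t ^ 3 * (1 - t) * Z * hi
    rw [this]
    repeat' (first | with_reducible assumption | exact one_mem _ | exact zero_mem _ | with_reducible apply add_mem | with_reducible apply sub_mem | with_reducible apply mul_mem | with_reducible apply pow_mem)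
  have mA : A ∈ C := by
    apply S.d4
    rw [e1]
    repeat' (first | with_reducible assumption | exact one_mem _ | exact zero_mem _ | with_reducible apply add_mem | with_reducible apply sub_mem | with_reducible apply mul_mem | with_reducible apply pow_mem)
  have mD : D ∈ C := by
    apply S.d4
    rw [e3]
    repeat' (first | with_reducible assumption | exact one_mem _ | exact zero_mem _ | with_reducible apply add_mem | with_reducible apply sub_mem | with_reducible apply mul_mem | with_reducible apply pow_mem)
  have mB : B ∈ C := by
    have : B = t * Z + b := by rw [hZ]; exact h2
    rw [this]
    repeat' (first | with_reducible assumption | exact one_mem _ | exact zero_mem _ | with_reducible apply add_mem | with_reducible apply sub_mem | with_reducible apply mul_mem | with_reducible apply pow_mem)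
  have mG : G ∈ C := by
    apply S.d0
    have : (1 - t) * G = t * (y' * A) + g := by linear_combination h4
    rw [this]
    repeat' (first | with_reducible assumption | exact one_mem _ | exact zero_mem _ | with_reducible apply add_mem | with_reducible apply sub_mem | with_reducible apply mul_mem | with_reducible apply pow_mem)
  have mH : H ∈ C := by
    apply S.d0
    have : (1 - t) * H = t * (y * D) + h := by linear_combination h5
    rw [this]
    repeat' (first | with_reducible assumption | exact one_mem _ | exact zero_mem _ | with_reducible apply add_mem | with_reducible apply sub_mem | with_reducible apply mul_mem | with_reducible apply pow_mem)
  exact ⟨mA, mB, mD, mG, mH⟩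

set_option maxHeartbeats 1000000 in
theorem Sys.elim {K : Type*} [CommRing K] {C : Subring K} {t y y' : K} (S : Sys C t y y') (F : ℕ → K)
    (h0 : F 0 = 1 + t * (y' ^ 2 * F 0 + y' * F 1 + y' * F 16 + F 3 + y' * F 17 + F 18 + F 19 + y * F 7 + y' * F 8 + F 9 + F 20 + y * F 11 + F 12 + y * F 13 + y * F 14 + y ^ 2 * F 27))
    (h1 : F 1 = 1 + t * (y' ^ 2 * F 26 + y' * F 1 + F 3 + F 18 + y * F 7 + F 9 + y * F 11 + y * F 13 + y ^ 2 * F 27))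
    (h2 : F 2 = 0 + t * (y' ^ 2 * F 26 + y' * F 2 + F 6 + F 10))
    (h3 : F 3 = 1 + t * (y' ^ 2 * F 26 + y' * F 1 + y' * F 2 + F 3 + F 5 + F 6 + y * F 7 + F 9 + F 10 + y * F 11 + y ^ 2 * F 27))
    (h4 : F 4 = 0 + t * (y' ^ 2 * F 26 + y' * F 4 + F 5 + F 6))
    (h5 : F 5 = 0 + t * (F 5))
    (h6 : F 6 = 0 + t * (y' ^ 2 * F 26 + y' * F 2 + y' * F 4 + F 6))
    (h7 : F 7 = 1 + t * (y' ^ 2 * F 26 + y' * F 1 + y' * F 2 + F 3 + y' * F 4 + F 21 + F 6 + y * F 7 + y ^ 2 * F 27))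
    (h8 : F 8 = 1 + t * (y' ^ 2 * F 26 + y' * F 8 + F 9 + F 20 + y * F 11 + F 12 + y * F 13 + y * F 14 + y ^ 2 * F 27))
    (h9 : F 9 = 0 + t * (F 9 + y * F 11 + y * F 13 + y ^ 2 * F 27))
    (h10 : F 10 = 0 + t * (F 10))
    (h11 : F 11 = 0 + t * (F 9 + F 10 + y * F 11 + y ^ 2 * F 27))
    (h12 : F 12 = 1 + t * (y' ^ 2 * F 26 + y' * F 4 + F 5 + F 6 + y' * F 8 + F 9 + F 10 + F 12 + y * F 13 + y * F 14 + y ^ 2 * F 27))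
    (h13 : F 13 = 0 + t * (F 5 + F 9 + y * F 13 + y ^ 2 * F 27))
    (h14 : F 14 = 1 + t * (y' ^ 2 * F 26 + y' * F 2 + y' * F 4 + F 6 + y' * F 8 + F 22 + F 12 + y * F 14 + y ^ 2 * F 27))
    (h15 : F 15 = 1 + t * (y' ^ 2 * F 26 + y' * F 1 + y' * F 2 + F 3 + y' * F 4 + F 21 + F 6 + y * F 7 + y' * F 8 + F 23 + F 22 + y * F 24 + F 12 + y * F 25 + y * F 14 + y ^ 2 * F 15))
    (h16 : F 16 = 1 + t * (y' ^ 2 * F 26 + y' * F 16 + F 3 + F 19 + y * F 7 + F 20 + y * F 11 + y * F 14 + y ^ 2 * F 27))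
    (h17 : F 17 = 1 + t * (y' ^ 2 * F 26 + y' * F 17 + F 18 + F 19 + y * F 7 + F 12 + y * F 13 + y * F 14 + y ^ 2 * F 27))
    (h18 : F 18 = 0 + t * (F 18 + y * F 7 + y * F 13 + y ^ 2 * F 27))
    (h19 : F 19 = 1 + t * (y' ^ 2 * F 26 + y' * F 16 + F 3 + y' * F 17 + F 5 + F 19 + y * F 7 + F 10 + F 12 + y * F 14 + y ^ 2 * F 27))
    (h20 : F 20 = 0 + t * (F 20 + y * F 11 + y * F 14 + y ^ 2 * F 27))
    (h21 : F 21 = 0 + t * (y' ^ 2 * F 26 + y' * F 1 + y' * F 4 + F 21))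
    (h22 : F 22 = 0 + t * (y' ^ 2 * F 26 + y' * F 2 + y' * F 8 + F 22))
    (h23 : F 23 = 1 + t * (y' ^ 2 * F 26 + y' * F 1 + F 3 + F 5 + y' * F 8 + F 23 + F 10 + y * F 24 + F 12 + y * F 25 + y ^ 2 * F 27))
    (h24 : F 24 = 1 + t * (y' ^ 2 * F 26 + y' * F 1 + y' * F 2 + F 3 + y' * F 8 + F 23 + F 22 + y * F 24 + y ^ 2 * F 27))
    (h25 : F 25 = 1 + t * (y' ^ 2 * F 26 + y' * F 1 + y' * F 4 + F 21 + y' * F 8 + F 23 + F 12 + y * F 25 + y ^ 2 * F 27))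
    (h26 : F 26 = 1 + t * (y' ^ 2 * F 26))
    (h27 : F 27 = 1 + t * (y ^ 2 * F 27))
    (h29 : F 29 = 1 + t * (y' ^ 2 * F 0 + y' * F 1 + y' * F 2 + F 3 + y' * F 4 + F 5 + F 6 + y * F 7 + y' * F 8 + F 9 + F 10 + y * F 11 + F 12 + y * F 13 + y * F 14 + y ^ 2 * F 15)) : F 29 ∈ C := by
  have ht := S.ht
  have hy := S.hy
  have hy' := S.hy'
  have m26 : F 26 ∈ C := by
    apply S.d2'
    have : (1 - t * y' ^ 2) * F 26 = 1 := by linear_combination h26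
    rw [this]
    exact one_mem _
  have m27 : F 27 ∈ C := by
    apply S.d2
    have : (1 - t * y ^ 2) * F 27 = 1 := by linear_combination h27
    rw [this]
    exact one_mem _
  have m5 : F 5 ∈ C := by
    apply S.d0
    have : (1 - t) * F 5 = 0 := by linear_combination h5
    rw [this]
    exact zero_mem _
  have m10 : F 10 ∈ C := by
    apply S.d0
    have : (1 - t) * F 10 = 0 := by linear_combination h10
    rw [this]
    exact zero_mem _
  have r9 : 0 + t * (y ^ 2 * F 27) ∈ C := by
    repeat' (first | with_reducible assumption | exact one_mem _ | exact zero_mem _ | with_reducible apply add_mem | with_reducible apply sub_mem | with_reducible apply mul_mem | with_reducible apply pow_mem)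
  have r11 : 0 + t * (F 10 + y ^ 2 * F 27) ∈ C := by
    repeat' (first | with_reducible assumption | exact one_mem _ | exact zero_mem _ | with_reducible apply add_mem | with_reducible apply sub_mem | with_reducible apply mul_mem | with_reducible apply pow_mem)
  have r13 : 0 + t * (F 5 + y ^ 2 * F 27) ∈ C := by
    repeat' (first | with_reducible assumption | exact one_mem _ | exact zero_mem _ | with_reducible apply add_mem | with_reducible apply sub_mem | with_reducible apply mul_mem | with_reducible apply pow_mem)
  obtain ⟨m9, m11, m13⟩ := S.trio (P := F 9) (Q := F 11) (R := F 13)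
    r9 r11 r13
    (by linear_combination h9)
    (by linear_combination h11)
    (by linear_combination h13)
  have r6 : 0 + t * (y' ^ 2 * F 26) ∈ C := by
    repeat' (first | with_reducible assumption | exact one_mem _ | exact zero_mem _ | with_reducible apply add_mem | with_reducible apply sub_mem | with_reducible apply mul_mem | with_reducible apply pow_mem)
  have r2 : 0 + t * (y' ^ 2 * F 26 + F 10) ∈ C := by
    repeat' (first | with_reducible assumption | exact one_mem _ | exact zero_mem _ | with_reducible apply add_mem | with_reducible apply sub_mem | with_reducible apply mul_mem | with_reducible apply pow_mem)
  have r4 : 0 + t * (y' ^ 2 * F 26 + F 5) ∈ C := by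
    repeat' (first | with_reducible assumption | exact one_mem _ | exact zero_mem _ | with_reducible apply add_mem | with_reducible apply sub_mem | with_reducible apply mul_mem | with_reducible apply pow_mem)
  obtain ⟨m6, m2, m4⟩ := S.symm.trio (P := F 6) (Q := F 2) (R := F 4)
    r6 r2 r4
    (by linear_combination h6)
    (by linear_combination h2)
    (by linear_combination h4)
  have r1 : 1 + t * (y' ^ 2 * F 26 + F 9 + y * F 11 + y * F 13 + y ^ 2 * F 27) ∈ C := by
    repeat' (first | with_reducible assumption | exact one_mem _ | exact zero_mem _ | with_reducible apply add_mem | with_reducible apply sub_mem | with_reducible apply mul_mem | with_reducible apply pow_mem)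
  have r3 : 1 + t * (y' ^ 2 * F 26 + y' * F 2 + F 5 + F 6 + F 9 + F 10 + y * F 11 + y ^ 2 * F 27) ∈ C := by
    repeat' (first | with_reducible assumption | exact one_mem _ | exact zero_mem _ | with_reducible apply add_mem | with_reducible apply sub_mem | with_reducible apply mul_mem | with_reducible apply pow_mem)
  have r7 : 1 + t * (y' ^ 2 * F 26 + y' * F 2 + y' * F 4 + F 6 + y ^ 2 * F 27) ∈ C := by
    repeat' (first | with_reducible assumption | exact one_mem _ | exact zero_mem _ | with_reducible apply add_mem | with_reducible apply sub_mem | with_reducible apply mul_mem | with_reducible apply pow_mem)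
  have r21 : 0 + t * (y' ^ 2 * F 26 + y' * F 4) ∈ C := by
    repeat' (first | with_reducible assumption | exact one_mem _ | exact zero_mem _ | with_reducible apply add_mem | with_reducible apply sub_mem | with_reducible apply mul_mem | with_reducible apply pow_mem)
  have r18 : 0 + t * (y * F 13 + y ^ 2 * F 27) ∈ C := by
    repeat' (first | with_reducible assumption | exact one_mem _ | exact zero_mem _ | with_reducible apply add_mem | with_reducible apply sub_mem | with_reducible apply mul_mem | with_reducible apply pow_mem)
  obtain ⟨m1, m3, m7, m21, m18⟩ := S.five (A := F 1) (B := F 3) (D := F 7) (G := F 21) (H := F 18)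
    r1 r3 r7 r21 r18
    (by linear_combination h1)
    (by linear_combination h3)
    (by linear_combination h7)
    (by linear_combination h21)
    (by linear_combination h18)
  have r8 : 1 + t * (y' ^ 2 * F 26 + F 9 + y * F 11 + y * F 13 + y ^ 2 * F 27) ∈ C := by
    repeat' (first | with_reducible assumption | exact one_mem _ | exact zero_mem _ | with_reducible apply add_mem | with_reducible apply sub_mem | with_reducible apply mul_mem | with_reducible apply pow_mem)
  have r12 : 1 + t * (y' ^ 2 * F 26 + y' * F 4 + F 5 + F 6 + F 9 + F 10 + y * F 13 + y ^ 2 * F 27) ∈ C := by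
    repeat' (first | with_reducible assumption | exact one_mem _ | exact zero_mem _ | with_reducible apply add_mem | with_reducible apply sub_mem | with_reducible apply mul_mem | with_reducible apply pow_mem)
  have r14 : 1 + t * (y' ^ 2 * F 26 + y' * F 2 + y' * F 4 + F 6 + y ^ 2 * F 27) ∈ C := by
    repeat' (first | with_reducible assumption | exact one_mem _ | exact zero_mem _ | with_reducible apply add_mem | with_reducible apply sub_mem | with_reducible apply mul_mem | with_reducible apply pow_mem)
  have r22 : 0 + t * (y' ^ 2 * F 26 + y' * F 2) ∈ C := by
    repeat' (first | with_reducible assumption | exact one_mem _ | exact zero_mem _ | with_reducible apply add_mem | with_reducible apply sub_mem | with_reducible apply mul_mem | with_reducible apply pow_mem)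
  have r20 : 0 + t * (y * F 11 + y ^ 2 * F 27) ∈ C := by
    repeat' (first | with_reducible assumption | exact one_mem _ | exact zero_mem _ | with_reducible apply add_mem | with_reducible apply sub_mem | with_reducible apply mul_mem | with_reducible apply pow_mem)
  obtain ⟨m8, m12, m14, m22, m20⟩ := S.five (A := F 8) (B := F 12) (D := F 14) (G := F 22) (H := F 20)
    r8 r12 r14 r22 r20
    (by linear_combination h8)
    (by linear_combination h12)
    (by linear_combination h14)
    (by linear_combination h22)
    (by linear_combination h20)
  have r23 : 1 + t * (y' ^ 2 * F 26 + y' * F 1 + F 3 + F 5 + y' * F 8 + F 10 + F 12 + y ^ 2 * F 27) ∈ C := by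
    repeat' (first | with_reducible assumption | exact one_mem _ | exact zero_mem _ | with_reducible apply add_mem | with_reducible apply sub_mem | with_reducible apply mul_mem | with_reducible apply pow_mem)
  have r24 : 1 + t * (y' ^ 2 * F 26 + y' * F 1 + y' * F 2 + F 3 + y' * F 8 + F 22 + y ^ 2 * F 27) ∈ C := by
    repeat' (first | with_reducible assumption | exact one_mem _ | exact zero_mem _ | with_reducible apply add_mem | with_reducible apply sub_mem | with_reducible apply mul_mem | with_reducible apply pow_mem)
  have r25 : 1 + t * (y' ^ 2 * F 26 + y' * F 1 + y' * F 4 + F 21 + y' * F 8 + F 12 + y ^ 2 * F 27) ∈ C := by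
    repeat' (first | with_reducible assumption | exact one_mem _ | exact zero_mem _ | with_reducible apply add_mem | with_reducible apply sub_mem | with_reducible apply mul_mem | with_reducible apply pow_mem)
  obtain ⟨m23, m24, m25⟩ := S.trio (P := F 23) (Q := F 24) (R := F 25)
    r23 r24 r25
    (by linear_combination h23)
    (by linear_combination h24)
    (by linear_combination h25)
  have r19 : 1 + t * (y' ^ 2 * F 26 + F 3 + F 5 + y * F 7 + F 10 + F 12 + y * F 14 + y ^ 2 * F 27) ∈ C := by
    repeat' (first | with_reducible assumption | exact one_mem _ | exact zero_mem _ | with_reducible apply add_mem | with_reducible apply sub_mem | with_reducible apply mul_mem | with_reducible apply pow_mem)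
  have r16 : 1 + t * (y' ^ 2 * F 26 + F 3 + y * F 7 + F 20 + y * F 11 + y * F 14 + y ^ 2 * F 27) ∈ C := by
    repeat' (first | with_reducible assumption | exact one_mem _ | exact zero_mem _ | with_reducible apply add_mem | with_reducible apply sub_mem | with_reducible apply mul_mem | with_reducible apply pow_mem)
  have r17 : 1 + t * (y' ^ 2 * F 26 + F 18 + y * F 7 + F 12 + y * F 13 + y * F 14 + y ^ 2 * F 27) ∈ C := by
    repeat' (first | with_reducible assumption | exact one_mem _ | exact zero_mem _ | with_reducible apply add_mem | with_reducible apply sub_mem | with_reducible apply mul_mem | with_reducible apply pow_mem)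
  obtain ⟨m19, m16, m17⟩ := S.symm.trio (P := F 19) (Q := F 16) (R := F 17)
    r19 r16 r17
    (by linear_combination h19)
    (by linear_combination h16)
    (by linear_combination h17)
  have r0 : 1 + t * (y' * F 1 + y' * F 16 + F 3 + y' * F 17 + F 18 + F 19 + y * F 7 + y' * F 8 + F 9 + F 20 + y * F 11 + F 12 + y * F 13 + y * F 14 + y ^ 2 * F 27) ∈ C := by
    repeat' (first | with_reducible assumption | exact one_mem _ | exact zero_mem _ | with_reducible apply add_mem | with_reducible apply sub_mem | with_reducible apply mul_mem | with_reducible apply pow_mem)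
  have m0 : F 0 ∈ C := by
    apply S.d2'
    have : (1 - t * y' ^ 2) * F 0 = 1 + t * (y' * F 1 + y' * F 16 + F 3 + y' * F 17 + F 18 + F 19 + y * F 7 + y' * F 8 + F 9 + F 20 + y * F 11 + F 12 + y * F 13 + y * F 14 + y ^ 2 * F 27) := by linear_combination h0
    rw [this]
    exact r0
  have r15 : 1 + t * (y' ^ 2 * F 26 + y' * F 1 + y' * F 2 + F 3 + y' * F 4 + F 21 + F 6 + y * F 7 + y' * F 8 + F 23 + F 22 + y * F 24 + F 12 + y * F 25 + y * F 14) ∈ C := by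
    repeat' (first | with_reducible assumption | exact one_mem _ | exact zero_mem _ | with_reducible apply add_mem | with_reducible apply sub_mem | with_reducible apply mul_mem | with_reducible apply pow_mem)
  have m15 : F 15 ∈ C := by
    apply S.d2
    have : (1 - t * y ^ 2) * F 15 = 1 + t * (y' ^ 2 * F 26 + y' * F 1 + y' * F 2 + F 3 + y' * F 4 + F 21 + F 6 + y * F 7 + y' * F 8 + F 23 + F 22 + y * F 24 + F 12 + y * F 25 + y * F 14) := by linear_combination h15
    rw [this]
    exact r15
  rw [h29]
  repeat' (first | with_reducible assumption | exact one_mem _ | exact zero_mem _ | with_reducible apply add_mem | with_reducible apply sub_mem | with_reducible apply mul_mem | with_reducible apply pow_mem)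

end Gerry

/-! ## Part 4: the concrete ring -/

namespace Gerry

open PowerSeries

theorem exists_sys : ∃ (s : PS) (d : Polynomial ℚ) (hs : s ^ 2 = (d : PS)),
    Sys (CC (W s d hs)) (rho X) (Y 1) (Y (-1)) := by
  obtain ⟨a, ha⟩ : ∃ a : Polynomial ℚ, a = 1 - 2 * Polynomial.X + Polynomial.X ^ 2
    - 2 * Polynomial.X ^ 3 - Polynomial.X ^ 4 := ⟨_, rfl⟩
  obtain ⟨b, hb⟩ : ∃ b : Polynomial ℚ, b = - Polynomial.X * (1 - Polynomial.X) := ⟨_, rfl⟩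
  have ha' : (a : PS) = 1 - 2 * X + X ^ 2 - 2 * X ^ 3 - X ^ 4 := by
    rw [ha]
    simp only [Polynomial.coe_sub, Polynomial.coe_add, Polynomial.coe_mul, Polynomial.coe_pow,
      Polynomial.coe_X, Polynomial.coe_one]
    have : ((2 : Polynomial ℚ) : PS) = 2 := by
      have h2 : (2 : Polynomial ℚ) = 1 + 1 := by norm_num
      rw [h2, Polynomial.coe_add, Polynomial.coe_one]; norm_num
    rw [this]
  have hb' : (b : PS) = - X * (1 - X) := by
    rw [hb]
    simp
  have hca : constantCoeff (a : PS) = 1 := by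
    rw [ha']; simp
  have hcb : constantCoeff (b : PS) = 0 := by
    rw [hb']; simp
  have hd : constantCoeff ((a ^ 2 - b ^ 2 - b ^ 2 - b ^ 2 - b ^ 2 : Polynomial ℚ) : PS) = 1 := by
    simp only [Polynomial.coe_sub, Polynomial.coe_pow, map_sub, map_pow, hca, hcb]; norm_num
  obtain ⟨s, hs, hcs⟩ := exists_sqrt _ hd
  refine ⟨s, _, hs, ?_⟩
  obtain ⟨w, hw⟩ : ∃ w, w = W s _ hs := ⟨_, rfl⟩
  rw [← hw]
  have hX : (X : PS) ∈ w := by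
    rw [hw, ← Polynomial.coe_X]; exact W.poly _
  have hs' : s ∈ w := by rw [hw]; exact W.root
  have maw : (a : PS) ∈ w := by rw [hw]; exact W.poly _
  have mbw : (b : PS) ∈ w := by rw [hw]; exact W.poly _
  have hsq : s ^ 2 = (a : PS) ^ 2 - 4 * (b : PS) ^ 2 := by
    rw [hs]
    simp only [Polynomial.coe_sub, Polynomial.coe_pow]; ring
  have hYY : Y 1 * Y (-1) = 1 := by rw [← Y_add]; norm_num [Y_zero]
  have hYY' : Y (-1) * Y 1 = 1 := by rw [← Y_add]; norm_num [Y_zero]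
  have h1X : (1 - X : PS) ∈ w := sub_mem (one_mem _) hX
  have hfac : ∀ c ∈ w, ∀ α ∈ w, constantCoeff c ≠ 0 → X ∣ α →
      ∀ (ε : ℤ) (e : ℕ), 1 ≤ e → rho c - rho α * Y (ε * e) ∈ Fac w ε :=
    fun c hc α hα h0 hx ε e he => ⟨c, hc, α, hα, e, he, h0, hx, rfl⟩
  have hdp : ∀ (e : ℕ), 1 ≤ e → ∀ c ∈ w, ∀ α ∈ w, constantCoeff c ≠ 0 → X ∣ α →
      rho c - rho α * Y 1 ^ e ∈ Den w := by
    intro e he c hc α hα h0 hx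
    have := Den.plus (hfac c hc α hα h0 hx 1 e he)
    rwa [show (1 : ℤ) * (e : ℤ) = e * 1 by ring, ← Y_pow] at this
  have hdm : ∀ (e : ℕ), 1 ≤ e → ∀ c ∈ w, ∀ α ∈ w, constantCoeff c ≠ 0 → X ∣ α →
      rho c - rho α * Y (-1) ^ e ∈ Den w := by
    intro e he c hc α hα h0 hx
    have := Den.minus (hfac c hc α hα h0 hx (-1) e he)
    rwa [show (-1 : ℤ) * (e : ℤ) = e * -1 by ring, ← Y_pow] at this
  have hc1 : constantCoeff (1 : PS) ≠ 0 := by simp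
  have hcX : constantCoeff (1 - X : PS) ≠ 0 := by simp
  have m3 : (X * (1 + X) : PS) ∈ w := mul_mem hX (add_mem (one_mem _) hX)
  refine
  { ht := CC.lam (Lam.rho hX)
    hy := CC.lam (Lam.Y _)
    hy' := CC.lam (Lam.Y _)
    inv := hYY
    d0 := ?_
    d1 := ?_
    d1' := ?_
    d2 := ?_
    d2' := ?_
    d3 := ?_
    d3' := ?_
    d4 := ?_
    d5 := ?_ }
  · intro x hx
    refine CC.div (Den.scalar h1X ?_) (q := rho (1 - X)) ?_
    · intro h; exact hcX (by rw [h]; simp)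
    · rwa [map_sub, map_one]
  · intro x hx
    refine CC.div (hdp 1 le_rfl 1 (one_mem _) X hX hc1 dvd_rfl) ?_
    rwa [map_one, pow_one]
  · intro x hx
    refine CC.div (hdm 1 le_rfl 1 (one_mem _) X hX hc1 dvd_rfl) ?_
    rwa [map_one, pow_one]
  · intro x hx
    refine CC.div (hdp 2 (by norm_num) 1 (one_mem _) X hX hc1 dvd_rfl) ?_
    rwa [map_one]
  · intro x hx
    refine CC.div (hdm 2 (by norm_num) 1 (one_mem _) X hX hc1 dvd_rfl) ?_
    rwa [map_one]
  · intro x hx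
    refine CC.div (hdp 1 le_rfl _ h1X _ m3 hcX (dvd_mul_right _ _)) ?_
    rwa [map_sub, map_one, pow_one, map_mul, map_add, map_one]
  · intro x hx
    refine CC.div (hdm 1 le_rfl _ h1X _ m3 hcX (dvd_mul_right _ _)) ?_
    rwa [map_sub, map_one, pow_one, map_mul, map_add, map_one]
  · intro x hx
    refine CC.div (Den.scalar (a := (1 - X) ^ 2 - X ^ 4) (sub_mem (pow_mem h1X _) (pow_mem hX _)) ?_) ?_
    · intro h
      have : constantCoeff ((1 - X) ^ 2 - X ^ 4 : PS) = 0 := by rw [h]; simp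
      simp at this
    · rwa [map_sub, map_pow, map_pow, map_sub, map_one]
  · intro x hx
    have mc : (a + s : PS) ∈ w := add_mem maw hs'
    have mα : (-(b + b) : PS) ∈ w := neg_mem (add_mem mbw mbw)
    have hc : constantCoeff ((a : PS) + s) ≠ 0 := by
      rw [map_add, hca, hcs]; norm_num
    have hdv : (X : PS) ∣ -(b + b) := by
      rw [hb']; exact ⟨(1 - X) + (1 - X), by ring⟩
    refine CC.div (hdp 1 le_rfl _ mc _ mα hc hdv) (CC.div (hdm 1 le_rfl _ mc _ mα hc hdv) ?_)
    have hk : rho s ^ 2 = rho (a : PS) ^ 2 - 4 * rho (b : PS) ^ 2 := by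
      rw [← map_pow, hsq, map_sub, map_mul, map_pow, map_pow, map_ofNat]
    have hA : rho (a : PS) = 1 - 2 * rho X + rho X ^ 2 - 2 * rho X ^ 3 - rho X ^ 4 := by
      rw [ha']; simp only [map_sub, map_add, map_mul, map_pow, map_one, map_ofNat]
    have hB : rho (b : PS) = - rho X * (1 - rho X) := by
      rw [hb']; simp only [map_sub, map_mul, map_neg, map_one]
    have key : (rho (a + s : PS) - rho (-(b + b) : PS) * Y (-1) ^ 1) *
        ((rho (a + s : PS) - rho (-(b + b) : PS) * Y 1 ^ 1) * x)
        = rho (a + s + (a + s) : PS) *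
          (((1 - 2 * rho X + rho X ^ 2 - 2 * rho X ^ 3 - rho X ^ 4)
            - rho X * (1 - rho X) * (Y 1 + Y (-1))) * x) := by
      have e1 : ((1 - 2 * rho X + rho X ^ 2 - 2 * rho X ^ 3 - rho X ^ 4)
            - rho X * (1 - rho X) * (Y 1 + Y (-1)) : RR)
            = rho (a : PS) + rho (b : PS) * (Y 1 + Y (-1)) := by
        rw [hA, hB]
        ring
      rw [e1]
      simp only [map_add, map_neg, pow_one]
      linear_combination x * hk + 4 * rho (b : PS) ^ 2 * x * hYY
    first
    | rw [key]
    | (rw [mul_left_comm, key])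
    exact mul_mem (CC.lam (Lam.rho (add_mem mc mc))) hx

end Gerry

/-! ## Part 5: colourings and the step lemmas -/

namespace Gerry

/-- Colour of row `i` in the column with mask `m`. -/
def bt (m : Fin 16) (i : Fin 4) : Bool := Nat.testBit m.val i.val

/-- Colour of a cell. -/
def col {n : ℕ} (c : Fin n → Fin 16) (x : Fin 4 × Fin n) : Bool := bt (c x.2) x.1

/-- Elementary monochromatic adjacency, with additional links `q` in the first column. -/
def E {n : ℕ} (q : Fin 4 → Fin 4 → Prop) (c : Fin n → Fin 16) (x y : Fin 4 × Fin n) : Prop :=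
  col c x = col c y ∧
    ((x.1 = y.1 ∧ x.2.val + 1 = y.2.val) ∨ (x.2 = y.2 ∧ x.1.val + 1 = y.1.val) ∨
      (x.2.val = 0 ∧ y.2.val = 0 ∧ q x.1 y.1))

/-- Both colour classes are connected (or empty), given the links `q`. -/
def Good {n : ℕ} (q : Fin 4 → Fin 4 → Prop) (c : Fin n → Fin 16) : Prop :=
  ∀ x y, col c x = col c y → Relation.EqvGen (E q c) x y

/-- Admissible link relations. -/
structure Adm (m : Fin 16) (q : Fin 4 → Fin 4 → Prop) : Prop where
  refl : ∀ i, q i i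
  symm : ∀ i j, q i j → q j i
  trans : ∀ i j k, q i j → q j k → q i k
  colour : ∀ i j, q i j → bt m i = bt m j
  vert : ∀ i j, bt m i = bt m j → i.val + 1 = j.val → q i j

theorem EqvGen.lift' {α β : Type*} {r : α → α → Prop} {s : β → β → Prop} (f : α → β)
    (h : ∀ x y, r x y → Relation.EqvGen s (f x) (f y)) {x y : α} (hxy : Relation.EqvGen r x y) :
    Relation.EqvGen s (f x) (f y) := by
  induction hxy with
  | rel x y hr => exact h x y hr
  | refl x => exact Relation.EqvGen.refl _
  | symm x y _ ih => exact Relation.EqvGen.symm _ _ ih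
  | trans x y z _ _ ih1 ih2 => exact Relation.EqvGen.trans _ _ _ ih1 ih2

theorem EqvGen.inv {α β : Type*} {r : α → α → Prop} (f : α → β)
    (h : ∀ x y, r x y → f x = f y) {x y : α} (hxy : Relation.EqvGen r x y) : f x = f y := by
  induction hxy with
  | rel x y hr => exact h x y hr
  | refl x => rfl
  | symm x y _ ih => exact ih.symm
  | trans x y z _ _ ih1 ih2 => exact ih1.trans ih2

/-- Shift a cell one column to the right. -/
def sh {n : ℕ} (x : Fin 4 × Fin n) : Fin 4 × Fin (n + 1) := (x.1, x.2.succ)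

@[simp] theorem col_sh {n : ℕ} (m : Fin 16) (c : Fin n → Fin 16) (x : Fin 4 × Fin n) :
    col (Fin.cons m c : Fin (n + 1) → Fin 16) (sh x) = col c x := by
  simp [col, sh]

@[simp] theorem col_zero {n : ℕ} (m : Fin 16) (c : Fin n → Fin 16) (i : Fin 4) :
    col (Fin.cons m c : Fin (n + 1) → Fin 16) (i, 0) = bt m i := by
  simp [col]

theorem cell_cases {n : ℕ} {P : Fin 4 × Fin (n + 1) → Prop} (h0 : ∀ i, P (i, 0))
    (h1 : ∀ x, P (sh x)) (x : Fin 4 × Fin (n + 1)) : P x := by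
  obtain ⟨i, j⟩ := x
  refine Fin.cases (h0 i) (fun j => ?_) j
  exact h1 (i, j)

/-- The four kinds of elementary adjacency. -/
theorem E_cases {n : ℕ} {q : Fin 4 → Fin 4 → Prop} {m : Fin 16} {d : Fin n → Fin 16}
    {P : Fin 4 × Fin (n + 1) → Fin 4 × Fin (n + 1) → Prop}
    (hv : ∀ i j, bt m i = bt m j → i.val + 1 = j.val → P (i, 0) (j, 0))
    (hq : ∀ i j, bt m i = bt m j → q i j → P (i, 0) (j, 0))
    (hh : ∀ x : Fin 4 × Fin n, x.2.val = 0 → bt m x.1 = col d x → P (x.1, 0) (sh x))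
    (hs : ∀ x y, E (fun _ _ => False) d x y → P (sh x) (sh y))
    (x y) (h : E q (Fin.cons m d : Fin (n + 1) → Fin 16) x y) : P x y := by
  revert y
  refine cell_cases (P := fun x => ∀ y, E q (Fin.cons m d : Fin (n + 1) → Fin 16) x y → P x y)
    (fun i y => ?_) (fun x y => ?_) x
  · refine cell_cases (P := fun y => E q (Fin.cons m d : Fin (n + 1) → Fin 16) (i, 0) y → P (i, 0) y)
      (fun j => ?_) (fun y => ?_) y
    · rintro ⟨hc, h | h | h⟩
      · simp at h
      · exact hv i j (by simpa using hc) h.2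
      · exact hq i j (by simpa using hc) h.2.2
    · rintro ⟨hc, h | h | h⟩
      · obtain ⟨h1, h2⟩ := h
        simp only [sh, Fin.val_succ] at h1 h2
        subst h1
        exact hh y (by simpa using h2.symm) (by simpa using hc)
      · simp only [sh] at h
        exact absurd h.1.symm (Fin.succ_ne_zero _)
      · simp [sh] at h
  · refine cell_cases (P := fun y => E q (Fin.cons m d : Fin (n + 1) → Fin 16) (sh x) y → P (sh x) y)
      (fun j => ?_) (fun y => ?_) y
    · rintro ⟨hc, h | h | h⟩
      · simp [sh] at h
      · simp [sh] at h
      · simp [sh] at h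
    · rintro ⟨hc, h⟩
      refine hs x y ⟨by simpa using hc, ?_⟩
      rcases h with h | h | h
      · left; simpa [sh] using h
      · right; left; simpa [sh] using h
      · simp [sh] at h

theorem E_sh {n : ℕ} {q : Fin 4 → Fin 4 → Prop} {m : Fin 16} {d : Fin n → Fin 16}
    {x y : Fin 4 × Fin n} (h : E (fun _ _ => False) d x y) :
    E q (Fin.cons m d : Fin (n + 1) → Fin 16) (sh x) (sh y) := by
  obtain ⟨hc, h⟩ := h
  refine ⟨by simpa using hc, ?_⟩
  rcases h with h | h | h
  · left; simpa [sh] using h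
  · right; left; simpa [sh] using h
  · exact absurd h.2.2 id

theorem E_hor {n : ℕ} {q : Fin 4 → Fin 4 → Prop} {m m1 : Fin 16} {c : Fin n → Fin 16}
    {i : Fin 4} (h : bt m i = bt m1 i) :
    E q (Fin.cons m (Fin.cons m1 c : Fin (n + 1) → Fin 16) : Fin (n + 2) → Fin 16)
      (i, 0) (sh (i, 0)) := by
  refine ⟨by simpa using h, Or.inl ?_⟩
  simp [sh]

theorem E_link {n : ℕ} {q : Fin 4 → Fin 4 → Prop} {m : Fin 16} {d : Fin n → Fin 16}
    {i j : Fin 4} (h : bt m i = bt m j) (hq : q i j) :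
    E q (Fin.cons m d : Fin (n + 1) → Fin 16) (i, 0) (j, 0) :=
  ⟨by simpa using h, Or.inr (Or.inr ⟨rfl, rfl, hq⟩)⟩

theorem E_mono {n : ℕ} {q q' : Fin 4 → Fin 4 → Prop} {d : Fin n → Fin 16}
    (hq : ∀ i j, q i j → q' i j) {x y : Fin 4 × Fin n} (h : E q d x y) : E q' d x y := by
  obtain ⟨hc, h⟩ := h
  refine ⟨hc, ?_⟩
  rcases h with h | h | h
  · exact Or.inl h
  · exact Or.inr (Or.inl h)
  · exact Or.inr (Or.inr ⟨h.1, h.2.1, hq _ _ h.2.2⟩)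

theorem good_live {n : ℕ} {q : Fin 4 → Fin 4 → Prop} {m m1 : Fin 16} {c : Fin n → Fin 16}
    (hq : Adm m q) (hl : ∀ i, ∃ j, q i j ∧ bt m j = bt m1 j) :
    Good q (Fin.cons m (Fin.cons m1 c : Fin (n + 1) → Fin 16) : Fin (n + 2) → Fin 16) ↔
      Good (fun i j => q i j ∧ bt m i = bt m1 i ∧ bt m j = bt m1 j)
        (Fin.cons m1 c : Fin (n + 1) → Fin 16) := by
  choose rep hr1 hr2 using hl
  have hcol : ∀ i, bt m i = bt m1 (rep i) := fun i => (hq.colour _ _ (hr1 i)).trans (hr2 i)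
  obtain ⟨r', hr'⟩ : ∃ r' : Fin 4 → Fin 4 → Prop,
    r' = fun i j => q i j ∧ bt m i = bt m1 i ∧ bt m j = bt m1 j := ⟨_, rfl⟩
  rw [← hr']
  constructor
  · intro hG x y hxy
    let φ : Fin 4 × Fin (n + 2) → Fin 4 × Fin (n + 1) := fun z =>
      Fin.cases (motive := fun _ => Fin 4 × Fin (n + 1)) (rep z.1, 0) (fun j => (z.1, j)) z.2
    have hφ0 : ∀ i, φ (i, 0) = (rep i, 0) := fun i => rfl
    have hφ1 : ∀ z, φ (sh z) = z := fun z => rfl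
    have hlink : ∀ i j, q i j → Relation.EqvGen
        (E r' (Fin.cons m1 c : Fin (n + 1) → Fin 16)) (rep i, 0) (rep j, 0) := by
      intro i j hij
      apply Relation.EqvGen.rel
      apply E_link
      · rw [← hcol, ← hcol]; exact hq.colour _ _ hij
      · rw [hr']
        exact ⟨hq.trans _ _ _ (hq.symm _ _ (hr1 i)) (hq.trans _ _ _ hij (hr1 j)), hr2 i, hr2 j⟩
    have key : ∀ z z', E q (Fin.cons m (Fin.cons m1 c : Fin (n + 1) → Fin 16) :
        Fin (n + 2) → Fin 16) z z' → Relation.EqvGen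
          (E r' (Fin.cons m1 c : Fin (n + 1) → Fin 16)) (φ z) (φ z') := by
      apply E_cases
      · intro i j hij h
        rw [hφ0, hφ0]
        exact hlink i j (hq.vert i j hij h)
      · intro i j _ h
        rw [hφ0, hφ0]
        exact hlink i j h
      · rintro ⟨i, j⟩ hj hcz
        have : j = 0 := Fin.ext hj
        subst this
        simp only [col_zero] at hcz
        rw [hφ0, hφ1]
        apply Relation.EqvGen.rel
        apply E_link
        · rw [← hcol]; exact hcz
        · rw [hr']
          exact ⟨hq.symm _ _ (hr1 i), hr2 i, hcz⟩
      · intro x y h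
        rw [hφ1, hφ1]
        exact Relation.EqvGen.rel _ _ (E_mono (fun _ _ h => h.elim) h)
    have := EqvGen.lift' φ key (hG (sh x) (sh y) (by simpa using hxy))
    rwa [hφ1, hφ1] at this
  · intro hG
    have up : ∀ x y, Relation.EqvGen (E r' (Fin.cons m1 c : Fin (n + 1) → Fin 16)) x y →
        Relation.EqvGen (E q (Fin.cons m (Fin.cons m1 c : Fin (n + 1) → Fin 16) :
          Fin (n + 2) → Fin 16)) (sh x) (sh y) := by
      intro x y h
      refine EqvGen.lift' sh ?_ h
      rintro x y ⟨hc, h⟩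
      by_cases h' : (x.1 = y.1 ∧ x.2.val + 1 = y.2.val) ∨ (x.2 = y.2 ∧ x.1.val + 1 = y.1.val)
      · exact Relation.EqvGen.rel _ _ (E_sh ⟨hc, h'.elim Or.inl (fun h => Or.inr (Or.inl h))⟩)
      · have h3 : x.2.val = 0 ∧ y.2.val = 0 ∧ r' x.1 y.1 := by tauto
        obtain ⟨i, a⟩ := x
        obtain ⟨j, b⟩ := y
        obtain ⟨ha, hb, hij⟩ := h3
        have ha : a = 0 := Fin.ext ha
        have hb : b = 0 := Fin.ext hb
        subst ha hb
        rw [hr'] at hij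
        obtain ⟨h1, h2, h3⟩ := hij
        refine Relation.EqvGen.trans _ _ _ (Relation.EqvGen.symm _ _ (Relation.EqvGen.rel _ _ (E_hor h2)))
          (Relation.EqvGen.trans _ _ _ (Relation.EqvGen.rel _ _ (E_link (hq.colour _ _ h1) h1))
            (Relation.EqvGen.rel _ _ (E_hor h3)))
    have toTail : ∀ x, ∃ x', col (Fin.cons m (Fin.cons m1 c : Fin (n + 1) → Fin 16) :
          Fin (n + 2) → Fin 16) x = col (Fin.cons m1 c : Fin (n + 1) → Fin 16) x' ∧
        Relation.EqvGen (E q (Fin.cons m (Fin.cons m1 c : Fin (n + 1) → Fin 16) :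
          Fin (n + 2) → Fin 16)) x (sh x') := by
      apply cell_cases
      · intro i
        refine ⟨(rep i, 0), by simpa using hcol i, ?_⟩
        exact Relation.EqvGen.trans _ _ _
          (Relation.EqvGen.rel _ _ (E_link (hq.colour _ _ (hr1 i)) (hr1 i)))
          (Relation.EqvGen.rel _ _ (E_hor (hr2 i)))
      · intro x
        exact ⟨x, by simp, Relation.EqvGen.refl _⟩
    intro x y hxy
    obtain ⟨x', hx1, hx2⟩ := toTail x
    obtain ⟨y', hy1, hy2⟩ := toTail y
    exact Relation.EqvGen.trans _ _ _ hx2 (Relation.EqvGen.trans _ _ _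
      (up _ _ (hG x' y' (hx1.symm.trans (hxy.trans hy1)))) (Relation.EqvGen.symm _ _ hy2))

theorem all_conn {n : ℕ} (d : Fin (n + 1) → Fin 16) (v : Bool) (h : ∀ x, col d x = v) (x) :
    Relation.EqvGen (E (fun _ _ => False) d) x (0, 0) := by
  obtain ⟨⟨i, hi⟩, ⟨j, hj⟩⟩ := x
  have h1 : ∀ j (hj : j < n + 1), Relation.EqvGen (E (fun _ _ => False) d) (⟨i, hi⟩, ⟨j, hj⟩)
      (⟨i, hi⟩, 0) := by
    intro j
    induction j with
    | zero => intro _; exact Relation.EqvGen.refl _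
    | succ j ih =>
      intro hj
      refine Relation.EqvGen.trans _ _ _ (Relation.EqvGen.symm _ _ (Relation.EqvGen.rel _ _ ?_))
        (ih (by omega))
      exact ⟨by rw [h, h], Or.inl ⟨rfl, rfl⟩⟩
  have h2 : ∀ i (hi : i < 4), Relation.EqvGen (E (fun _ _ => False) d) (⟨i, hi⟩, 0) (0, 0) := by
    intro i
    induction i with
    | zero => intro _; exact Relation.EqvGen.refl _
    | succ i ih =>
      intro hi
      refine Relation.EqvGen.trans _ _ _ (Relation.EqvGen.symm _ _ (Relation.EqvGen.rel _ _ ?_))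
        (ih (by omega))
      exact ⟨by rw [h, h], Or.inr (Or.inl ⟨rfl, rfl⟩)⟩
  exact Relation.EqvGen.trans _ _ _ (h1 j hj) (h2 i hi)

theorem good_closed {n : ℕ} {q : Fin 4 → Fin 4 → Prop} {m m1 : Fin 16} {c : Fin n → Fin 16}
    (hq : Adm m q) (hl : ¬ ∀ i, ∃ j, q i j ∧ bt m j = bt m1 j) :
    Good q (Fin.cons m (Fin.cons m1 c : Fin (n + 1) → Fin 16) : Fin (n + 2) → Fin 16) ↔
      ∃ v, ((∀ i, bt m1 i = v) ∧ ∀ i j, bt m i ≠ v → bt m j ≠ v → q i j) ∧ ∀ x, col c x = v := by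
  constructor
  · intro hG
    push Not at hl
    obtain ⟨i, hi⟩ := hl
    have key : ∀ z z', E q (Fin.cons m (Fin.cons m1 c : Fin (n + 1) → Fin 16) :
        Fin (n + 2) → Fin 16) z z' → (z.2 = 0 ∧ q i z.1) = (z'.2 = 0 ∧ q i z'.1) := by
      apply E_cases
      · intro a b hab h
        have := hq.vert _ _ hab h
        simp only [true_and, eq_iff_iff]
        exact ⟨fun h => hq.trans _ _ _ h this, fun h => hq.trans _ _ _ h (hq.symm _ _ this)⟩
      · intro a b _ this
        simp only [true_and, eq_iff_iff]
        exact ⟨fun h => hq.trans _ _ _ h this, fun h => hq.trans _ _ _ h (hq.symm _ _ this)⟩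
      · rintro ⟨a, b⟩ hb hcz
        have : b = 0 := Fin.ext hb
        subst this
        simp only [col_zero] at hcz
        simp only [sh, true_and, eq_iff_iff]
        exact ⟨fun h => absurd hcz (hi _ h), fun h => absurd h.1 (Fin.succ_ne_zero _)⟩
      · intro x y _
        simp only [sh, eq_iff_iff]
        exact ⟨fun h => absurd h.1 (Fin.succ_ne_zero _), fun h => absurd h.1 (Fin.succ_ne_zero _)⟩
    have hK : ∀ z, bt m i = col (Fin.cons m (Fin.cons m1 c : Fin (n + 1) → Fin 16) :
        Fin (n + 2) → Fin 16) z → z.2 = 0 ∧ q i z.1 := by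
      intro z hz
      have := EqvGen.inv _ key (hG (i, 0) z (by simpa using hz))
      rw [← this]
      exact ⟨rfl, hq.refl i⟩
    have htail : ∀ x, col (Fin.cons m1 c : Fin (n + 1) → Fin 16) x = !(bt m i) := by
      intro x
      by_contra hne
      have hne : bt m i = col (Fin.cons m1 c : Fin (n + 1) → Fin 16) x := by
        revert hne
        cases bt m i <;> cases col (Fin.cons m1 c : Fin (n + 1) → Fin 16) x <;> simp
      have := hK (sh x) (by simpa using hne)
      exact absurd this.1 (Fin.succ_ne_zero _)
    refine ⟨!(bt m i), ⟨fun j => ?_, fun a b ha hb => ?_⟩, fun x => ?_⟩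
    · have := htail (j, 0)
      simpa using this
    · have ha : bt m i = bt m a := by
        revert ha
        cases bt m i <;> cases bt m a <;> simp
      have hb : bt m i = bt m b := by
        revert hb
        cases bt m i <;> cases bt m b <;> simp
      have h1 := (hK (a, 0) (by simpa using ha)).2
      have h2 := (hK (b, 0) (by simpa using hb)).2
      exact hq.trans _ _ _ (hq.symm _ _ h1) h2
    · have := htail (sh x)
      simpa using this
  · rintro ⟨v, ⟨h1, h2⟩, h3⟩
    have hd : ∀ x, col (Fin.cons m1 c : Fin (n + 1) → Fin 16) x = v := by
      apply cell_cases
      · intro i; simpa using h1 i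
      · intro x; simpa using h3 x
    have hv : ∀ x, col (Fin.cons m (Fin.cons m1 c : Fin (n + 1) → Fin 16) :
        Fin (n + 2) → Fin 16) x = v → Relation.EqvGen (E q (Fin.cons m
          (Fin.cons m1 c : Fin (n + 1) → Fin 16) : Fin (n + 2) → Fin 16)) x (sh (0, 0)) := by
      have ht : ∀ x, Relation.EqvGen (E q (Fin.cons m
          (Fin.cons m1 c : Fin (n + 1) → Fin 16) : Fin (n + 2) → Fin 16)) (sh x) (sh (0, 0)) :=
        fun x => EqvGen.lift' sh (fun x y h => Relation.EqvGen.rel _ _ (E_sh h))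
          (all_conn _ v hd x)
      apply cell_cases
      · intro i hi
        refine Relation.EqvGen.trans _ _ _ (Relation.EqvGen.rel _ _ (E_hor ?_)) (ht (i, 0))
        rw [h1]; simpa using hi
      · intro x _
        exact ht x
    have hn : ∀ x, col (Fin.cons m (Fin.cons m1 c : Fin (n + 1) → Fin 16) :
        Fin (n + 2) → Fin 16) x ≠ v → ∃ i, x = (i, 0) ∧ bt m i ≠ v := by
      apply cell_cases
      · intro i hi
        exact ⟨i, rfl, by simpa using hi⟩
      · intro x hx
        rw [col_sh, hd] at hx
        exact absurd rfl hx
    intro x y hxy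
    by_cases hx : col (Fin.cons m (Fin.cons m1 c : Fin (n + 1) → Fin 16) :
        Fin (n + 2) → Fin 16) x = v
    · exact Relation.EqvGen.trans _ _ _ (hv x hx)
        (Relation.EqvGen.symm _ _ (hv y (hxy.symm.trans hx)))
    · obtain ⟨i, rfl, hi⟩ := hn x hx
      obtain ⟨j, rfl, hj⟩ := hn y (by rwa [← hxy])
      exact Relation.EqvGen.rel _ _ (E_link (by simpa using hxy) (h2 i j hi hj))

/-- One elementary link inside a column. -/
def lk (m : Fin 16) (r : Fin 4 → Fin 4 → Prop) (a b : Fin 4) : Prop :=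
  bt m a = bt m b ∧ (a = b ∨ a.val + 1 = b.val ∨ b.val + 1 = a.val ∨ r a b)

theorem good_congr {n : ℕ} {m : Fin 16} {c : Fin n → Fin 16} {r r1 : Fin 4 → Fin 4 → Prop}
    (h1 : ∀ i j, r i j → r1 i j)
    (h2 : ∀ i j, r1 i j → ∃ k l, lk m r i k ∧ lk m r k l ∧ lk m r l j) :
    Good r (Fin.cons m c : Fin (n + 1) → Fin 16) ↔ Good r1 (Fin.cons m c : Fin (n + 1) → Fin 16) := by
  have hlk : ∀ i j, lk m r i j → Relation.EqvGen (E r (Fin.cons m c : Fin (n + 1) → Fin 16))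
      (i, 0) (j, 0) := by
    rintro i j ⟨hc, rfl | h | h | h⟩
    · exact Relation.EqvGen.refl _
    · exact Relation.EqvGen.rel _ _ ⟨by simpa using hc, Or.inr (Or.inl ⟨rfl, h⟩)⟩
    · exact Relation.EqvGen.symm _ _
        (Relation.EqvGen.rel _ _ ⟨by simpa using hc.symm, Or.inr (Or.inl ⟨rfl, h⟩)⟩)
    · exact Relation.EqvGen.rel _ _ (E_link hc h)
  constructor
  · intro hG x y hxy
    exact EqvGen.lift' id (fun x y h => Relation.EqvGen.rel _ _ (E_mono h1 h)) (hG x y hxy)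
  · intro hG x y hxy
    refine EqvGen.lift' id ?_ (hG x y hxy)
    apply E_cases
    · intro i j hc h
      exact hlk i j ⟨hc, Or.inr (Or.inl h)⟩
    · intro i j _ h
      obtain ⟨k, l, a1, a2, a3⟩ := h2 i j h
      exact Relation.EqvGen.trans _ _ _ (hlk _ _ a1)
        (Relation.EqvGen.trans _ _ _ (hlk _ _ a2) (hlk _ _ a3))
    · rintro ⟨i, j⟩ hj hc
      refine Relation.EqvGen.rel _ _ ⟨by simpa using hc, Or.inl ⟨rfl, ?_⟩⟩
      simpa [sh] using hj
    · intro x y h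
      exact Relation.EqvGen.rel _ _ (E_sh h)

theorem good_single {q : Fin 4 → Fin 4 → Prop} {m : Fin 16} {c : Fin 0 → Fin 16} (hq : Adm m q) :
    Good q (Fin.cons m c : Fin 1 → Fin 16) ↔ ∀ i j, bt m i = bt m j → q i j := by
  constructor
  · intro hG i j hij
    have key : ∀ z z', E q (Fin.cons m c : Fin 1 → Fin 16) z z' → (q i z.1) = (q i z'.1) := by
      apply E_cases
      · intro a b hab h
        have := hq.vert _ _ hab h
        simp only [eq_iff_iff]
        exact ⟨fun h => hq.trans _ _ _ h this, fun h => hq.trans _ _ _ h (hq.symm _ _ this)⟩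
      · intro a b _ this
        simp only [eq_iff_iff]
        exact ⟨fun h => hq.trans _ _ _ h this, fun h => hq.trans _ _ _ h (hq.symm _ _ this)⟩
      · intro x; exact x.2.elim0
      · intro x; exact x.2.elim0
    have := EqvGen.inv _ key (hG (i, 0) (j, 0) (by simpa using hij))
    rw [← this]
    exact hq.refl i
  · intro h
    intro x
    refine cell_cases (P := fun x => ∀ y, col (Fin.cons m c : Fin 1 → Fin 16) x =
      col (Fin.cons m c : Fin 1 → Fin 16) y → Relation.EqvGen (E q (Fin.cons m c : Fin 1 → Fin 16)) x y)
      (fun i y => ?_) (fun x => x.2.elim0) x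
    refine cell_cases (P := fun y => col (Fin.cons m c : Fin 1 → Fin 16) (i, 0) =
      col (Fin.cons m c : Fin 1 → Fin 16) y → Relation.EqvGen (E q (Fin.cons m c : Fin 1 → Fin 16)) (i, 0) y)
      (fun j hij => ?_) (fun x => x.2.elim0) y
    have hij : bt m i = bt m j := by simpa using hij
    exact Relation.EqvGen.rel _ _ (E_link hij (h i j hij))

end Gerry

/-! ## Part 6: the transfer automaton -/

namespace Gerry

/-- Masks of the live states. -/
def maskTab : List (Fin 16) :=
  [0, 1, 2, 3, 4, 5, 6, 7, 8, 9, 10, 11, 12, 13, 14, 15, 2, 4, 5, 6, 10, 5, 10, 9, 11, 13]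

/-- Link classes of the live states. -/
def labTab : List (List ℕ) :=
  [[0, 0, 0, 0], [0, 1, 1, 1], [0, 1, 2, 2], [0, 0, 2, 2], [0, 0, 2, 3], [0, 1, 2, 3],
   [0, 1, 1, 3], [0, 0, 0, 3], [0, 0, 0, 3], [0, 1, 1, 3], [0, 1, 2, 3], [0, 0, 2, 3],
   [0, 0, 2, 2], [0, 1, 2, 2], [0, 1, 1, 1], [0, 0, 0, 0], [0, 1, 0, 0], [0, 0, 2, 0],
   [0, 1, 2, 1], [0, 1, 1, 0], [0, 1, 0, 3], [0, 1, 0, 3], [0, 1, 2, 1], [0, 1, 1, 0],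
   [0, 0, 2, 0], [0, 1, 0, 0]]

/-- Transition table; 26 and 27 are the closed states, 28 is dead, 29 is the start. -/
def stepTab : List (List ℕ) :=
  [[0, 1, 16, 3, 17, 18, 19, 7, 8, 9, 20, 11, 12, 13, 14, 27],
   [26, 1, 28, 3, 28, 18, 28, 7, 28, 9, 28, 11, 28, 13, 28, 27],
   [26, 28, 2, 28, 28, 28, 6, 28, 28, 28, 10, 28, 28, 28, 28, 28],
   [26, 1, 2, 3, 28, 5, 6, 7, 28, 9, 10, 11, 28, 28, 28, 27],
   [26, 28, 28, 28, 4, 5, 6, 28, 28, 28, 28, 28, 28, 28, 28, 28],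
   [28, 28, 28, 28, 28, 5, 28, 28, 28, 28, 28, 28, 28, 28, 28, 28],
   [26, 28, 2, 28, 4, 28, 6, 28, 28, 28, 28, 28, 28, 28, 28, 28],
   [26, 1, 2, 3, 4, 21, 6, 7, 28, 28, 28, 28, 28, 28, 28, 27],
   [26, 28, 28, 28, 28, 28, 28, 28, 8, 9, 20, 11, 12, 13, 14, 27],
   [28, 28, 28, 28, 28, 28, 28, 28, 28, 9, 28, 11, 28, 13, 28, 27],
   [28, 28, 28, 28, 28, 28, 28, 28, 28, 28, 10, 28, 28, 28, 28, 28],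
   [28, 28, 28, 28, 28, 28, 28, 28, 28, 9, 10, 11, 28, 28, 28, 27],
   [26, 28, 28, 28, 4, 5, 6, 28, 8, 9, 10, 28, 12, 13, 14, 27],
   [28, 28, 28, 28, 28, 5, 28, 28, 28, 9, 28, 28, 28, 13, 28, 27],
   [26, 28, 2, 28, 4, 28, 6, 28, 8, 28, 22, 28, 12, 28, 14, 27],
   [26, 1, 2, 3, 4, 21, 6, 7, 8, 23, 22, 24, 12, 25, 14, 15],
   [26, 28, 16, 3, 28, 28, 19, 7, 28, 28, 20, 11, 28, 28, 14, 27],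
   [26, 28, 28, 28, 17, 18, 19, 7, 28, 28, 28, 28, 12, 13, 14, 27],
   [28, 28, 28, 28, 28, 18, 28, 7, 28, 28, 28, 28, 28, 13, 28, 27],
   [26, 28, 16, 3, 17, 5, 19, 7, 28, 28, 10, 28, 12, 28, 14, 27],
   [28, 28, 28, 28, 28, 28, 28, 28, 28, 28, 20, 11, 28, 28, 14, 27],
   [26, 1, 28, 28, 4, 21, 28, 28, 28, 28, 28, 28, 28, 28, 28, 28],
   [26, 28, 2, 28, 28, 28, 28, 28, 8, 28, 22, 28, 28, 28, 28, 28],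
   [26, 1, 28, 3, 28, 5, 28, 28, 8, 23, 10, 24, 12, 25, 28, 27],
   [26, 1, 2, 3, 28, 28, 28, 28, 8, 23, 22, 24, 28, 28, 28, 27],
   [26, 1, 28, 28, 4, 21, 28, 28, 8, 23, 28, 28, 12, 25, 28, 27],
   [26, 28, 28, 28, 28, 28, 28, 28, 28, 28, 28, 28, 28, 28, 28, 28],
   [28, 28, 28, 28, 28, 28, 28, 28, 28, 28, 28, 28, 28, 28, 28, 27],
   [28, 28, 28, 28, 28, 28, 28, 28, 28, 28, 28, 28, 28, 28, 28, 28],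
   [0, 1, 2, 3, 4, 5, 6, 7, 8, 9, 10, 11, 12, 13, 14, 15]]

/-- Accepting states. -/
def accTab : List Bool :=
  [true, true, false, true, false, false, false, true, true, false,
   false, false, true, false, true, true, true, true, false, true,
   false, false, false, true, true, true, true, true, false, true]

/-- Mask of a live state. -/
def mk (k : ℕ) : Fin 16 := maskTab.getD k 0

/-- Link class of a row in a live state. -/
def lb (k : ℕ) (i : Fin 4) : ℕ := (labTab.getD k []).getD i.val 0

/-- Transition function. -/
def step (k : ℕ) (m : Fin 16) : ℕ := (stepTab.getD k []).getD m.val 28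

/-- Acceptance. -/
def acc (k : ℕ) : Bool := accTab.getD k false

/-- Link relation of a live state. -/
def rel (k : ℕ) (i j : Fin 4) : Prop := lb k i = lb k j

instance (k : ℕ) (i j : Fin 4) : Decidable (rel k i j) := inferInstanceAs (Decidable (_ = _))

/-- Links surviving in the next column. -/
def surv (k : ℕ) (m : Fin 16) (i j : Fin 4) : Prop :=
  rel k i j ∧ bt (mk k) i = bt m i ∧ bt (mk k) j = bt m j

instance (k : ℕ) (m : Fin 16) (i j : Fin 4) : Decidable (surv k m i j) :=
  inferInstanceAs (Decidable (_ ∧ _))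

instance (m : Fin 16) (r : Fin 4 → Fin 4 → Prop) [∀ i j, Decidable (r i j)] (a b : Fin 4) :
    Decidable (lk m r a b) := inferInstanceAs (Decidable (_ ∧ _))

/-- No component is closed off by the next column. -/
def live (k : ℕ) (m : Fin 16) : Prop := ∀ i, ∃ j, rel k i j ∧ bt (mk k) j = bt m j

instance (k : ℕ) (m : Fin 16) : Decidable (live k m) := inferInstanceAs (Decidable (∀ _, _))

/-- The condition for closing off the colour opposite to `v`. -/
def clo (k : ℕ) (m : Fin 16) (v : Bool) : Prop :=
  (∀ i, bt m i = v) ∧ ∀ i j, bt (mk k) i ≠ v → bt (mk k) j ≠ v → rel k i j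

instance (k : ℕ) (m : Fin 16) (v : Bool) : Decidable (clo k m v) :=
  inferInstanceAs (Decidable (_ ∧ _))

/-- Connection by at most three links. -/
def path3 (k : ℕ) (m : Fin 16) (i j : Fin 4) : Prop :=
  ∃ a b, lk m (surv k m) i a ∧ lk m (surv k m) a b ∧ lk m (surv k m) b j

instance (k : ℕ) (m : Fin 16) (i j : Fin 4) : Decidable (path3 k m i j) :=
  inferInstanceAs (Decidable (∃ a b, lk m (surv k m) i a ∧ lk m (surv k m) a b ∧
    lk m (surv k m) b j))

theorem tab_adm : ∀ k < 26, (∀ i j, rel k i j → bt (mk k) i = bt (mk k) j) ∧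
    (∀ i j : Fin 4, bt (mk k) i = bt (mk k) j → i.val + 1 = j.val → rel k i j) := by
  decide +kernel

theorem tab_live : ∀ k < 26, ∀ m, live k m → step k m < 26 ∧ mk (step k m) = m ∧
    (∀ i j, surv k m i j → rel (step k m) i j) ∧
    (∀ i j, rel (step k m) i j → path3 k m i j) := by
  decide +kernel

theorem tab_clo : ∀ k < 26, ∀ m, ¬ live k m →
    (clo k m false ∧ ¬ clo k m true ∧ step k m = 26) ∨
    (clo k m true ∧ ¬ clo k m false ∧ step k m = 27) ∨
    (¬ clo k m true ∧ ¬ clo k m false ∧ step k m = 28) := by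
  decide +kernel

theorem tab_acc : ∀ k < 26, (acc k = true ↔ ∀ i j, bt (mk k) i = bt (mk k) j → rel k i j) := by
  decide +kernel

theorem tab_init : ∀ m : Fin 16, step 29 m < 26 ∧ mk (step 29 m) = m ∧
    (∀ i j, rel (step 29 m) i j → ∃ a b, lk m (fun _ _ => False) i a ∧
      lk m (fun _ _ => False) a b ∧ lk m (fun _ _ => False) b j) := by
  decide +kernel

theorem tab_c0 : ∀ m : Fin 16, ((∀ i, bt m i = false) ∧ step 26 m = 26) ∨
    ((¬ ∀ i, bt m i = false) ∧ step 26 m = 28) := by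
  decide +kernel

theorem tab_c1 : ∀ m : Fin 16, ((∀ i, bt m i = true) ∧ step 27 m = 27) ∨
    ((¬ ∀ i, bt m i = true) ∧ step 27 m = 28) := by
  decide +kernel

theorem tab_dead : ∀ m : Fin 16, step 28 m = 28 := by
  decide +kernel

theorem adm_rel (k : ℕ) (hk : k < 26) : Adm (mk k) (rel k) where
  refl := fun _ => rfl
  symm := fun _ _ h => Eq.symm h
  trans := fun _ _ _ h h' => Eq.trans h h'
  colour := (tab_adm k hk).1
  vert := (tab_adm k hk).2

/-- Meaning of the states. -/
def Sem (k : ℕ) {n : ℕ} (c : Fin n → Fin 16) : Prop :=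
  if k < 26 then Good (rel k) (Fin.cons (mk k) c : Fin (n + 1) → Fin 16)
  else if k = 26 then ∀ x, col c x = false
  else if k = 27 then ∀ x, col c x = true
  else if k = 28 then False
  else Good (fun _ _ => False) c

theorem Sem_live {k : ℕ} (hk : k < 26) {n : ℕ} (c : Fin n → Fin 16) :
    Sem k c ↔ Good (rel k) (Fin.cons (mk k) c : Fin (n + 1) → Fin 16) := by
  simp [Sem, hk]

theorem all_cons {n : ℕ} (m : Fin 16) (c : Fin n → Fin 16) (v : Bool) :
    (∀ x, col (Fin.cons m c : Fin (n + 1) → Fin 16) x = v) ↔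
      (∀ i, bt m i = v) ∧ ∀ x, col c x = v := by
  constructor
  · intro h
    exact ⟨fun i => by simpa using h (i, 0), fun x => by simpa using h (sh x)⟩
  · rintro ⟨h1, h2⟩
    apply cell_cases
    · intro i; simpa using h1 i
    · intro x; simpa using h2 x

theorem Sem_26 {n : ℕ} (c : Fin n → Fin 16) : Sem 26 c ↔ ∀ x, col c x = false := by
  simp [Sem]

theorem Sem_27 {n : ℕ} (c : Fin n → Fin 16) : Sem 27 c ↔ ∀ x, col c x = true := by
  simp [Sem]

theorem Sem_28 {n : ℕ} (c : Fin n → Fin 16) : ¬ Sem 28 c := by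
  simp [Sem]

theorem Sem_29 {n : ℕ} (c : Fin n → Fin 16) : Sem 29 c ↔ Good (fun _ _ => False) c := by
  simp [Sem]

theorem Sem_step (k : ℕ) (hk : k < 30) (m : Fin 16) {n : ℕ} (c : Fin n → Fin 16) :
    Sem k (Fin.cons m c : Fin (n + 1) → Fin 16) ↔ Sem (step k m) c := by
  by_cases h : k < 26
  · rw [Sem_live h]
    by_cases hl : live k m
    · obtain ⟨h1, h2, h3, h4⟩ := tab_live k h m hl
      rw [good_live (adm_rel k h) hl, Sem_live h1, h2]
      exact good_congr h3 h4
    · rw [good_closed (adm_rel k h) hl]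
      have e : (∃ v, ((∀ i, bt m i = v) ∧ ∀ i j, bt (mk k) i ≠ v → bt (mk k) j ≠ v → rel k i j) ∧
          ∀ x, col c x = v) ↔ ∃ v, clo k m v ∧ ∀ x, col c x = v := Iff.rfl
      rw [e, Bool.exists_bool]
      rcases tab_clo k h m hl with ⟨a1, a2, a3⟩ | ⟨a1, a2, a3⟩ | ⟨a1, a2, a3⟩
      · rw [a3, Sem_26]; tauto
      · rw [a3, Sem_27]; tauto
      · rw [a3]
        have := Sem_28 c
        tauto
  · obtain rfl | rfl | rfl | rfl : k = 26 ∨ k = 27 ∨ k = 28 ∨ k = 29 := by omega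
    · rw [Sem_26, all_cons]
      rcases tab_c0 m with ⟨a1, a2⟩ | ⟨a1, a2⟩
      · rw [a2, Sem_26]; tauto
      · rw [a2]
        have := Sem_28 c
        tauto
    · rw [Sem_27, all_cons]
      rcases tab_c1 m with ⟨a1, a2⟩ | ⟨a1, a2⟩
      · rw [a2, Sem_27]; tauto
      · rw [a2]
        have := Sem_28 c
        tauto
    · rw [tab_dead]
      exact ⟨fun h => absurd h (Sem_28 _), fun h => absurd h (Sem_28 _)⟩
    · obtain ⟨h1, h2, h3⟩ := tab_init m
      rw [Sem_29, Sem_live h1, h2]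
      exact good_congr (fun _ _ h => h.elim) h3

theorem Sem_acc (k : ℕ) (hk : k < 30) (c : Fin 0 → Fin 16) : Sem k c ↔ acc k = true := by
  by_cases h : k < 26
  · rw [Sem_live h, good_single (adm_rel k h), tab_acc k h]
  · obtain rfl | rfl | rfl | rfl : k = 26 ∨ k = 27 ∨ k = 28 ∨ k = 29 := by omega
    · rw [Sem_26]
      exact ⟨fun _ => by decide, fun _ x => x.2.elim0⟩
    · rw [Sem_27]
      exact ⟨fun _ => by decide, fun _ x => x.2.elim0⟩
    · exact ⟨fun h => absurd h (Sem_28 _), fun h => absurd h (by decide)⟩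
    · rw [Sem_29]
      exact ⟨fun _ => by decide, fun _ x => x.2.elim0⟩

end Gerry

/-! ## Part 7: generating functions -/

namespace Gerry

open PowerSeries

/-- Weight of a column: number of cells of colour `true`, minus 2. -/
def wt (m : Fin 16) : ℤ := (∑ i : Fin 4, if bt m i then 1 else 0) - 2

open Classical in
/-- Generating polynomial of colourings recognised from state `k`. -/
noncomputable def Wk (k n : ℕ) : LP :=
  ∑ c : Fin n → Fin 16, if Sem k c then LaurentPolynomial.T (∑ j, wt (c j)) else 0

theorem Wk_zero (k : ℕ) (hk : k < 30) : Wk k 0 = if acc k = true then 1 else 0 := by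
  classical
  unfold Wk
  rw [Fintype.sum_unique]
  simp only [Sem_acc k hk]
  simp

theorem Wk_succ (k : ℕ) (hk : k < 30) (n : ℕ) :
    Wk k (n + 1) = ∑ m : Fin 16, LaurentPolynomial.T (wt m) * Wk (step k m) n := by
  classical
  unfold Wk
  rw [← (Fin.consEquiv (fun _ : Fin (n + 1) => Fin 16)).sum_comp, Fintype.sum_prod_type]
  refine Finset.sum_congr rfl fun m _ => ?_
  rw [Finset.mul_sum]
  refine Finset.sum_congr rfl fun c _ => ?_
  have e : (Fin.consEquiv (fun _ : Fin (n + 1) => Fin 16)) (m, c) = Fin.cons m c := rfl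
  rw [e]
  simp only [Sem_step k hk m c]
  split_ifs
  · rw [Fin.sum_univ_succ, LaurentPolynomial.T_add]
    simp only [Fin.cons_zero, Fin.cons_succ]
  · rw [mul_zero]

/-- Generating series of state `k`. -/
noncomputable def FF (k : ℕ) : RR := PowerSeries.mk fun n => Wk k n

theorem rho_X : rho X = (X : RR) := by simp [rho]

theorem FF_eq (k : ℕ) (hk : k < 30) :
    FF k = (if acc k = true then 1 else 0) + rho X * ∑ m : Fin 16, Y (wt m) * FF (step k m) := by
  rw [rho_X]
  ext1 n
  cases n with
  | zero =>
    rw [map_add, coeff_zero_X_mul, add_zero]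
    simp only [FF, coeff_mk, Wk_zero k hk]
    split_ifs <;> simp
  | succ n =>
    rw [map_add, coeff_succ_X_mul, map_sum]
    have : coeff (n + 1) (if acc k = true then 1 else 0 : RR) = 0 := by
      split_ifs <;> simp [coeff_one]
    rw [this, zero_add]
    simp only [FF, coeff_mk, Wk_succ k hk, Y, coeff_C_mul]

theorem FF_28 : FF 28 = 0 := by
  ext1 n
  simp [FF, Wk, Sem_28]

theorem wt_tab : wt 0 = -2 ∧ wt 1 = -1 ∧ wt 2 = -1 ∧ wt 3 = 0 ∧ wt 4 = -1 ∧ wt 5 = 0 ∧ wt 6 = 0 ∧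
    wt 7 = 1 ∧ wt 8 = -1 ∧ wt 9 = 0 ∧ wt 10 = 0 ∧ wt 11 = 1 ∧ wt 12 = 0 ∧ wt 13 = 1 ∧ wt 14 = 1 ∧
    wt 15 = 2 := by decide +kernel

theorem FF_mem {C : Subring RR} (S : Sys C (rho X) (Y 1) (Y (-1))) : FF 29 ∈ C := by
  have h2 : Y 2 = Y 1 ^ 2 := by rw [Y_pow]; norm_num
  have h2' : Y (-2) = Y (-1) ^ 2 := by rw [Y_pow]; norm_num
  obtain ⟨w0, w1, w2, w3, w4, w5, w6, w7, w8, w9, w10, w11, w12, w13, w14, w15⟩ := wt_tab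
  have key : ∀ k, k < 30 → FF k = (if acc k = true then 1 else 0) + rho X *
      (Y (-1) ^ 2 * FF (step k 0) + Y (-1) * FF (step k 1) + Y (-1) * FF (step k 2)
        + FF (step k 3) + Y (-1) * FF (step k 4) + FF (step k 5) + FF (step k 6)
        + Y 1 * FF (step k 7) + Y (-1) * FF (step k 8) + FF (step k 9) + FF (step k 10)
        + Y 1 * FF (step k 11) + FF (step k 12) + Y 1 * FF (step k 13) + Y 1 * FF (step k 14)
        + Y 1 ^ 2 * FF (step k 15)) := by
    intro k hk
    rw [FF_eq k hk]
    have : ∀ f : Fin 16 → RR, ∑ m, f m = f 0 + f 1 + f 2 + f 3 + f 4 + f 5 + f 6 + f 7 + f 8 + f 9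
        + f 10 + f 11 + f 12 + f 13 + f 14 + f 15 := by
      intro f
      simp only [Fin.sum_univ_succ, Fin.sum_univ_zero]
      simp only [add_assoc, add_zero]
      rfl
    rw [this, w0, w1, w2, w3, w4, w5, w6, w7, w8, w9, w10, w11, w12, w13, w14, w15, Y_zero, h2, h2']
    simp only [one_mul]
  have key2 : ∀ k, k < 30 → ∀ (b : Bool) (s0 s1 s2 s3 s4 s5 s6 s7 s8 s9 s10 s11 s12 s13 s14 s15 : ℕ),
      (acc k = b ∧ step k 0 = s0 ∧ step k 1 = s1 ∧ step k 2 = s2 ∧ step k 3 = s3 ∧ step k 4 = s4 ∧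
        step k 5 = s5 ∧ step k 6 = s6 ∧ step k 7 = s7 ∧ step k 8 = s8 ∧ step k 9 = s9 ∧
        step k 10 = s10 ∧ step k 11 = s11 ∧ step k 12 = s12 ∧ step k 13 = s13 ∧ step k 14 = s14 ∧
        step k 15 = s15) → FF k = (if b = true then 1 else 0) + rho X *
      (Y (-1) ^ 2 * FF s0 + Y (-1) * FF s1 + Y (-1) * FF s2
        + FF s3 + Y (-1) * FF s4 + FF s5 + FF s6
        + Y 1 * FF s7 + Y (-1) * FF s8 + FF s9 + FF s10
        + Y 1 * FF s11 + FF s12 + Y 1 * FF s13 + Y 1 * FF s14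
        + Y 1 ^ 2 * FF s15) := by
    rintro k hk b s0 s1 s2 s3 s4 s5 s6 s7 s8 s9 s10 s11 s12 s13 s14 s15
      ⟨rfl, rfl, rfl, rfl, rfl, rfl, rfl, rfl, rfl, rfl, rfl, rfl, rfl, rfl, rfl, rfl, rfl⟩
    exact key k hk
  apply S.elim FF
  · simpa [FF_28] using key2 0 (by norm_num) true 0 1 16 3 17 18 19 7 8 9 20 11 12 13 14 27 (by decide)
  · simpa [FF_28] using key2 1 (by norm_num) true 26 1 28 3 28 18 28 7 28 9 28 11 28 13 28 27 (by decide)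
  · simpa [FF_28] using key2 2 (by norm_num) false 26 28 2 28 28 28 6 28 28 28 10 28 28 28 28 28 (by decide)
  · simpa [FF_28] using key2 3 (by norm_num) true 26 1 2 3 28 5 6 7 28 9 10 11 28 28 28 27 (by decide)
  · simpa [FF_28] using key2 4 (by norm_num) false 26 28 28 28 4 5 6 28 28 28 28 28 28 28 28 28 (by decide)
  · simpa [FF_28] using key2 5 (by norm_num) false 28 28 28 28 28 5 28 28 28 28 28 28 28 28 28 28 (by decide)
  · simpa [FF_28] using key2 6 (by norm_num) false 26 28 2 28 4 28 6 28 28 28 28 28 28 28 28 28 (by decide)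
  · simpa [FF_28] using key2 7 (by norm_num) true 26 1 2 3 4 21 6 7 28 28 28 28 28 28 28 27 (by decide)
  · simpa [FF_28] using key2 8 (by norm_num) true 26 28 28 28 28 28 28 28 8 9 20 11 12 13 14 27 (by decide)
  · simpa [FF_28] using key2 9 (by norm_num) false 28 28 28 28 28 28 28 28 28 9 28 11 28 13 28 27 (by decide)
  · simpa [FF_28] using key2 10 (by norm_num) false 28 28 28 28 28 28 28 28 28 28 10 28 28 28 28 28 (by decide)
  · simpa [FF_28] using key2 11 (by norm_num) false 28 28 28 28 28 28 28 28 28 9 10 11 28 28 28 27 (by decide)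
  · simpa [FF_28] using key2 12 (by norm_num) true 26 28 28 28 4 5 6 28 8 9 10 28 12 13 14 27 (by decide)
  · simpa [FF_28] using key2 13 (by norm_num) false 28 28 28 28 28 5 28 28 28 9 28 28 28 13 28 27 (by decide)
  · simpa [FF_28] using key2 14 (by norm_num) true 26 28 2 28 4 28 6 28 8 28 22 28 12 28 14 27 (by decide)
  · simpa [FF_28] using key2 15 (by norm_num) true 26 1 2 3 4 21 6 7 8 23 22 24 12 25 14 15 (by decide)
  · simpa [FF_28] using key2 16 (by norm_num) true 26 28 16 3 28 28 19 7 28 28 20 11 28 28 14 27 (by decide)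
  · simpa [FF_28] using key2 17 (by norm_num) true 26 28 28 28 17 18 19 7 28 28 28 28 12 13 14 27 (by decide)
  · simpa [FF_28] using key2 18 (by norm_num) false 28 28 28 28 28 18 28 7 28 28 28 28 28 13 28 27 (by decide)
  · simpa [FF_28] using key2 19 (by norm_num) true 26 28 16 3 17 5 19 7 28 28 10 28 12 28 14 27 (by decide)
  · simpa [FF_28] using key2 20 (by norm_num) false 28 28 28 28 28 28 28 28 28 28 20 11 28 28 14 27 (by decide)
  · simpa [FF_28] using key2 21 (by norm_num) false 26 1 28 28 4 21 28 28 28 28 28 28 28 28 28 28 (by decide)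
  · simpa [FF_28] using key2 22 (by norm_num) false 26 28 2 28 28 28 28 28 8 28 22 28 28 28 28 28 (by decide)
  · simpa [FF_28] using key2 23 (by norm_num) true 26 1 28 3 28 5 28 28 8 23 10 24 12 25 28 27 (by decide)
  · simpa [FF_28] using key2 24 (by norm_num) true 26 1 2 3 28 28 28 28 8 23 22 24 28 28 28 27 (by decide)
  · simpa [FF_28] using key2 25 (by norm_num) true 26 1 28 28 4 21 28 28 8 23 28 28 12 25 28 27 (by decide)
  · simpa [FF_28] using key2 26 (by norm_num) true 26 28 28 28 28 28 28 28 28 28 28 28 28 28 28 28 (by decide)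
  · simpa [FF_28] using key2 27 (by norm_num) true 28 28 28 28 28 28 28 28 28 28 28 28 28 28 28 27 (by decide)
  · simpa [FF_28] using key2 29 (by norm_num) true 0 1 2 3 4 5 6 7 8 9 10 11 12 13 14 15 (by decide)

/-- Column-wise colouring of a set is a bijection. -/
theorem bt_bij : Function.Bijective bt := by
  rw [Fintype.bijective_iff_injective_and_card]
  constructor
  · intro a b h
    have h' : ∀ i, bt a i = bt b i := fun i => by rw [h]
    revert a b
    have : ∀ a b : Fin 16, (∀ i, bt a i = bt b i) → a = b := by decide +kernel
    intro a b _ h'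
    exact this a b h'
  · simp

end Gerry

/-! ## Part 8: counting dissections -/

namespace Gerry

open PowerSeries

/-- The region of colour `v`. -/
def reg {n : ℕ} (c : Fin n → Fin 16) (v : Bool) : Finset (Fin 4 × Fin n) :=
  Finset.univ.filter fun x => col c x = v

theorem mem_reg {n : ℕ} {c : Fin n → Fin 16} {v : Bool} {x : Fin 4 × Fin n} :
    x ∈ reg c v ↔ col c x = v := by simp [reg]

theorem reg_compl {n : ℕ} (c : Fin n → Fin 16) : (reg c true)ᶜ = reg c false := by
  ext x
  simp [mem_reg]

theorem reg_bij (n : ℕ) : Function.Bijective (fun c : Fin n → Fin 16 => reg c true) := by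
  classical
  constructor
  · intro c c' h
    funext j
    apply bt_bij.1
    funext i
    have : ((i, j) ∈ reg c true) ↔ ((i, j) ∈ reg c' true) := by
      have h' : reg c true = reg c' true := h
      rw [h']
    rw [mem_reg, mem_reg] at this
    exact Bool.eq_iff_iff.2 this
  · intro S
    choose g hg using fun j : Fin n => bt_bij.2 (fun i : Fin 4 => decide ((i, j) ∈ S))
    refine ⟨g, ?_⟩
    ext x
    simp only [mem_reg, col]
    rw [hg]
    simp

theorem reg_card {n : ℕ} (c : Fin n → Fin 16) :
    (reg c true).card = 2 * n ↔ ∑ j, wt (c j) = 0 := by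
  have h1 : ((reg c true).card : ℤ) = ∑ j, ∑ i, if bt (c j) i then 1 else 0 := by
    rw [reg, Finset.card_filter]
    push_cast
    rw [Fintype.sum_prod_type_right]
    rfl
  have h2 : ∑ j, wt (c j) = ((reg c true).card : ℤ) - 2 * n := by
    rw [h1]
    simp only [wt, Finset.sum_sub_distrib]
    simp [mul_comm]
  rw [h2]
  omega

theorem grid_adj {n : ℕ} {c : Fin n → Fin 16} {x y : Fin 4 × Fin n} (hc : col c x = col c y)
    (h : (gridGraph 4 n).Adj x y) :
    Relation.EqvGen (E (fun _ _ => False) c) x y := by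
  rw [gridGraph, SimpleGraph.fromRel_adj] at h
  rcases h.2 with h | h
  · exact Relation.EqvGen.rel _ _ ⟨hc, h.elim Or.inl fun h => Or.inr (Or.inl h)⟩
  · exact Relation.EqvGen.symm _ _
      (Relation.EqvGen.rel _ _ ⟨hc.symm, h.elim Or.inl fun h => Or.inr (Or.inl h)⟩)

theorem adj_grid {n : ℕ} {c : Fin n → Fin 16} {x y : Fin 4 × Fin n}
    (h : E (fun _ _ => False) c x y) : (gridGraph 4 n).Adj x y := by
  rw [gridGraph, SimpleGraph.fromRel_adj]
  obtain ⟨_, h | h | h⟩ := h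
  · refine ⟨?_, Or.inl (Or.inl h)⟩
    rintro rfl
    omega
  · refine ⟨?_, Or.inl (Or.inr h)⟩
    rintro rfl
    omega
  · exact h.2.2.elim

theorem good_of_conn {n : ℕ} {c : Fin n → Fin 16} (h : ∀ v, ConnectedRegion 4 n (reg c v)) :
    Good (fun _ _ => False) c := by
  intro x y hxy
  have hx : x ∈ (reg c (col c x) : Set (Fin 4 × Fin n)) := by
    rw [Finset.mem_coe, mem_reg]
  have hy : y ∈ (reg c (col c x) : Set (Fin 4 × Fin n)) := by
    rw [Finset.mem_coe, mem_reg, hxy]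
  obtain ⟨p⟩ := (h (col c x)).preconnected ⟨x, hx⟩ ⟨y, hy⟩
  have key : ∀ (a b : (reg c (col c x) : Set (Fin 4 × Fin n))),
      ((gridGraph 4 n).induce (reg c (col c x) : Set (Fin 4 × Fin n))).Walk a b →
      Relation.EqvGen (E (fun _ _ => False) c) a.1 b.1 := by
    intro a b p
    induction p with
    | nil => exact Relation.EqvGen.refl _
    | cons hadj _ ih =>
      rename_i u v w _
      refine Relation.EqvGen.trans _ _ _ (grid_adj ?_ hadj) ih
      have hu := mem_reg.1 (Finset.mem_coe.1 u.2)
      have hv := mem_reg.1 (Finset.mem_coe.1 v.2)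
      exact hu.trans hv.symm
  exact key _ _ p

theorem conn_of_good {n : ℕ} {c : Fin n → Fin 16} (h : Good (fun _ _ => False) c) (v : Bool)
    (hne : (reg c v).Nonempty) : ConnectedRegion 4 n (reg c v) := by
  have key : ∀ x y, Relation.EqvGen (E (fun _ _ => False) c) x y →
      (col c x = col c y) ∧ ∀ (hx : x ∈ (reg c v : Set (Fin 4 × Fin n)))
        (hy : y ∈ (reg c v : Set (Fin 4 × Fin n))),
        ((gridGraph 4 n).induce (reg c v : Set (Fin 4 × Fin n))).Reachable ⟨x, hx⟩ ⟨y, hy⟩ := by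
    intro x y hxy
    induction hxy with
    | rel x y hr =>
      refine ⟨hr.1, fun hx hy => SimpleGraph.Adj.reachable ?_⟩
      exact adj_grid hr
    | refl x => exact ⟨rfl, fun hx hy => SimpleGraph.Reachable.refl _⟩
    | symm x y _ ih => exact ⟨ih.1.symm, fun hx hy => (ih.2 hy hx).symm⟩
    | trans x y z _ _ ih1 ih2 =>
      refine ⟨ih1.1.trans ih2.1, fun hx hz => ?_⟩
      have hy : y ∈ (reg c v : Set (Fin 4 × Fin n)) := by
        rw [Finset.mem_coe, mem_reg, ← ih1.1]
        exact mem_reg.1 (Finset.mem_coe.1 hx)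
      exact (ih1.2 hx hy).trans (ih2.2 hy hz)
  obtain ⟨x0, hx0⟩ := hne
  haveI : Nonempty (reg c v : Set (Fin 4 × Fin n)) := ⟨⟨x0, hx0⟩⟩
  refine SimpleGraph.Connected.mk ?_
  rintro ⟨x, hx⟩ ⟨y, hy⟩
  refine (key x y (h x y ?_)).2 hx hy
  rw [mem_reg.1 (Finset.mem_coe.1 hx), mem_reg.1 (Finset.mem_coe.1 hy)]

theorem card_eq (n : ℕ) (hn : 1 ≤ n) :
    Nat.card {S : Finset (Fin 4 × Fin n) //
        S.card = 2 * n ∧ ConnectedRegion 4 n S ∧ ConnectedRegion 4 n Sᶜ} =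
      Nat.card {c : Fin n → Fin 16 // Sem 29 c ∧ ∑ j, wt (c j) = 0} := by
  symm
  refine Nat.card_congr ((Equiv.ofBijective _ (reg_bij n)).subtypeEquiv fun c => ?_)
  simp only [Equiv.ofBijective_apply]
  rw [Sem_29, reg_compl, reg_card]
  constructor
  · rintro ⟨hG, hw⟩
    have h1 := (reg_card c).2 hw
    have h2 : (reg c false).card = 2 * n := by
      rw [← reg_compl, Finset.card_compl, h1]
      simp
      omega
    exact ⟨hw, conn_of_good hG _ (Finset.card_pos.1 (by omega)),
      conn_of_good hG _ (Finset.card_pos.1 (by omega))⟩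
  · rintro ⟨hw, h1, h2⟩
    refine ⟨good_of_conn fun v => ?_, hw⟩
    cases v
    · exact h2
    · exact h1

theorem coeff_FF (n : ℕ) : coeff n (kap 0 (FF 29)) =
    (Nat.card {c : Fin n → Fin 16 // Sem 29 c ∧ ∑ j, wt (c j) = 0} : ℚ) := by
  classical
  rw [Nat.card_eq_fintype_card, Fintype.card_subtype, Finset.card_filter]
  simp only [kap, FF, coeff_mk, Wk]
  rw [lp_coeff_sum]
  push_cast
  refine Finset.sum_congr rfl fun c _ => ?_
  by_cases h : Sem 29 c
  · have := lp_T_mul (∑ j, wt (c j)) 0 1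
    rw [mul_one] at this
    simp only [h, if_true, true_and]
    rw [this]
    have h1 := congrArg (coeff 0) (kap_one (0 - ∑ j, wt (c j)))
    simp only [kap, coeff_mk, coeff_zero_one] at h1
    rw [h1]
    by_cases h2 : ∑ j, wt (c j) = 0
    · simp [h2]
    · have h3 : ¬ (0 - ∑ j, wt (c j) = 0) := by omega
      rw [if_neg h3, if_neg h2, map_zero]
  · simp [h]

end Gerry

/-- Let `b 0 = 1` and, for `n ≥ 1`, let `b n` be half the number of subsets `S` of
the `4 × n` board with `|S| = 2n` such that both `S` and its complement are
connected. Then `f(t) = ∑ bₙ tⁿ ∈ ℚ[[t]]` is algebraic of degree at most 2 over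
`ℚ(t)`: there are polynomials `c₂ ≠ 0`, `c₁`, `c₀` in `ℚ[t]` with
`c₂·f² + c₁·f + c₀ = 0`. -/
theorem gerrymander_4xn_algebraic (b : ℕ → ℕ) (hb0 : b 0 = 1)
    (hb : ∀ n : ℕ, 1 ≤ n →
      2 * b n = Nat.card {S : Finset (Fin 4 × Fin n) //
        S.card = 2 * n ∧ ConnectedRegion 4 n S ∧ ConnectedRegion 4 n Sᶜ}) :
    ∃ c₂ c₁ c₀ : Polynomial ℚ, c₂ ≠ 0 ∧
      (c₂ : PowerSeries ℚ) * (PowerSeries.mk fun n => (b n : ℚ)) ^ 2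
        + (c₁ : PowerSeries ℚ) * (PowerSeries.mk fun n => (b n : ℚ))
        + (c₀ : PowerSeries ℚ) = 0 := by
  obtain ⟨s, d, hs, S⟩ := Gerry.exists_sys
  have hdiv : ∀ g f : Gerry.PS, g ∈ Gerry.W s d hs → g ≠ 0 → g * f ∈ Gerry.W s d hs →
      f ∈ Gerry.W s d hs := fun g f hg hg0 h => Gerry.W.div hg hg0 h
  have h1 := Gerry.CC.kap hdiv (Gerry.FF_mem S) 0
  apply Gerry.W.quadratic (s := s) (d := d) (hs := hs)
  refine hdiv 2 _ ?_ ?_ ?_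
  · have : (2 : Gerry.PS) = 1 + 1 := by norm_num
    rw [this]
    exact add_mem (one_mem _) (one_mem _)
  · intro h
    have h3 := congrArg PowerSeries.constantCoeff h
    rw [map_ofNat, map_zero] at h3
    exact absurd h3 (by norm_num)
  · have e : (2 : Gerry.PS) * (PowerSeries.mk fun n => (b n : ℚ)) = Gerry.kap 0 (Gerry.FF 29) + 1 := by
      ext n
      have e2 : (2 : Gerry.PS) = PowerSeries.C (2 : ℚ) := by rw [map_ofNat]
      rw [e2, PowerSeries.coeff_C_mul, PowerSeries.coeff_mk, map_add, Gerry.coeff_FF,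
        PowerSeries.coeff_one]
      rcases Nat.eq_zero_or_pos n with rfl | hn
      · have : Nat.card {c : Fin 0 → Fin 16 // Gerry.Sem 29 c ∧ ∑ j, Gerry.wt (c j) = 0} = 1 := by
          rw [Nat.card_eq_one_iff_unique]
          refine ⟨inferInstance, ⟨⟨Fin.elim0, ?_, by simp⟩⟩⟩
          rw [Gerry.Sem_acc 29 (by norm_num)]
          decide
        rw [this, hb0]
        norm_num
      · have := hb n hn
        rw [Gerry.card_eq n hn] at this
        rw [← this]
        have hne : n ≠ 0 := by omega
        push_cast
        simp [hne]
    rw [e]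
    exact add_mem h1 (one_mem _)
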